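/- arXiv:2511.02316 — 2 statements merged into one kernel-verified Lean document; each statement's English description precedes it below -/
import Mathlib

section
/- For every ε ∈ (0,1) and every α ∈ (0, ε/2), for all sufficiently large n, P(ξ(n) ≤ (1 - ε/2) λ log n) ≤ exp(-n^α). -/
open MeasureTheory ProbabilityTheory Filter Set
open scoped ENNReal NNReal

variable {Ω : Type*}

/-- Partial sums of the steps: `S X n = X 0 + ⋯ + X (n-1)` (the walk started at `0`). -/
noncomputable def S (X : ℕ → Ω → ℤ) (n : ℕ) (ω : Ω) : ℤ :=
  ∑ i ∈ Finset.range n, X i ω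

/-- The local time at site `z` up to time `n`: `ξ(z,n) = #{k : 0 < k ≤ n, S_k = z}`. -/
noncomputable def localTime (X : ℕ → Ω → ℤ) (z : ℤ) (n : ℕ) (ω : Ω) : ℕ :=
  ((Finset.Icc 1 n).filter (fun k => S X k ω = z)).card

/-- The maximal local time `ξ(n) = max_{y ∈ ℤ} ξ(y,n)`. -/
noncomputable def maxLocalTime (X : ℕ → Ω → ℤ) (n : ℕ) (ω : Ω) : ℕ :=
  sSup (Set.range fun z : ℤ => localTime X z n ω)

/-- The set of favorite sites at time `n`: `K(n) = {z : ξ(z,n) = ξ(n)}`. -/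
noncomputable def favSites (X : ℕ → Ω → ℤ) (n : ℕ) (ω : Ω) : Set ℤ :=
  {z : ℤ | localTime X z n ω = maxLocalTime X n ω}

/-- The total local time at site `z`: `ξ(z,∞) = #{k > 0 : S_k = z}` (as an extended natural). -/
noncomputable def totalLocalTime (X : ℕ → Ω → ℤ) (z : ℤ) (ω : Ω) : ℕ∞ :=
  {k : ℕ | 0 < k ∧ S X k ω = z}.encard

/-- `X` is a sequence of i.i.d. steps with `P(X_i = 1) = p`, `P(X_i = -1) = q`. -/
def IsAsymmetricSRW [MeasurableSpace Ω] (P : Measure Ω) (X : ℕ → Ω → ℤ) (p q : ℝ) : Prop :=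
  (∀ i, Measurable (X i)) ∧
  iIndepFun X P ∧
  (∀ i, P {ω | X i ω = 1} = ENNReal.ofReal p) ∧
  (∀ i, P {ω | X i ω = -1} = ENNReal.ofReal q)
/-- probability to hit zero at a positive time at most `t`, from `x` -/
noncomputable def uu (p q : ℝ) : ℕ → ℤ → ℝ
  | 0, _ => 0
  | t+1, x => p * (if x + 1 = 0 then 1 else uu p q t (x+1))
      + q * (if x + -1 = 0 then 1 else uu p q t (x + -1))

/-- transition of the state machine -/
def stp (k m : ℕ) : ℕ × ℕ × ℕ × ℤ → ℤ → ℕ × ℕ × ℕ × ℤ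
  | (b, 0, t, x), _ => (b, 0, t, x)
  | (0, r+1, 0, x), _ => (0, r+1, 0, x)
  | (b+1, _+1, 0, _), _ => (b, k+1, m, 0)
  | (b, r+1, t+1, x), e => if x + e = 0 then (b, r, m, 0) else (b, r+1, t, x+e)

def stt (k m : ℕ) (s0 : ℕ × ℕ × ℕ × ℤ) (x : ℕ → ℤ) : ℕ → ℕ × ℕ × ℕ × ℤ
  | 0 => s0
  | n+1 => stp k m (stt k m s0 x n) (x n)

noncomputable def VV (p q : ℝ) (k m : ℕ) : ℕ × ℕ × ℕ × ℤ → ℝ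
  | (_, 0, _, _) => 0
  | (b, r+1, t, x) => (1 - uu p q t x * (uu p q m 0)^r) * (1 - (uu p q m 0)^(k+1))^b

lemma uu_mem (p q : ℝ) (hp : 0 ≤ p) (hq : 0 ≤ q) (hpq : p + q = 1) (t : ℕ) :
    ∀ x, 0 ≤ uu p q t x ∧ uu p q t x ≤ 1 := by
  induction t with
  | zero => intro x; simp [uu]
  | succ t ih =>
    intro x
    have key : ∀ y : ℤ, 0 ≤ (if y = 0 then 1 else uu p q t y) ∧
        (if y = 0 then 1 else uu p q t y) ≤ 1 := by
      intro y; split_ifs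
      · simp
      · exact ih y
    have h1 := key (x+1)
    have h2 := key (x + -1)
    simp only [uu]
    constructor
    · have := mul_nonneg hp h1.1
      have := mul_nonneg hq h2.1
      linarith
    · have := mul_le_mul_of_nonneg_left h1.2 hp
      have := mul_le_mul_of_nonneg_left h2.2 hq
      linarith

lemma uu_mono (p q : ℝ) (hp : 0 ≤ p) (hq : 0 ≤ q) (hpq : p + q = 1) (x : ℤ) :
    Monotone (fun t => uu p q t x) := by
  apply monotone_nat_of_le_succ
  intro t
  induction t generalizing x with
  | zero => exact (uu_mem p q hp hq hpq 1 x).1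
  | succ t ih =>
    have key : ∀ y : ℤ, (if y = 0 then (1:ℝ) else uu p q t y) ≤
        (if y = 0 then 1 else uu p q (t+1) y) := by
      intro y; split_ifs
      · simp
      · exact ih y
    have := mul_le_mul_of_nonneg_left (key (x+1)) hp
    have := mul_le_mul_of_nonneg_left (key (x + -1)) hq
    rw [uu, uu]
    linarith

lemma ruin_aux (a : ℕ → ℝ) (A C : ℝ) (hA : 0 < A) (h0 : a 0 = 1) (hnn : ∀ j, 0 ≤ a j)
    (hrec : ∀ j, A * (a (j+1) - a (j+2)) = C * (a j - a (j+1))) (N : ℕ) :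
    (1 - a 1) * ∑ i ∈ Finset.range N, (C/A)^i ≤ 1 := by
  have hd : ∀ j, a j - a (j+1) = (1 - a 1) * (C/A)^j := by
    intro j
    induction j with
    | zero => simp [h0]
    | succ j ih =>
      have h := hrec j
      rw [ih] at h
      have : a (j+1) - a (j+1+1) = C * ((1 - a 1) * (C/A)^j) / A := by
        rw [eq_div_iff hA.ne']; linarith
      rw [this, pow_succ]; ring
  have hs : ∑ i ∈ Finset.range N, (a i - a (i+1)) = a 0 - a N := Finset.sum_range_sub' a N
  rw [Finset.mul_sum, ← Finset.sum_congr rfl (fun i _ => hd i), hs, h0]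
  linarith [hnn N]

lemma uu_large (p q : ℝ) (hq0 : 0 < q) (hq : q < 1/2) (hpq : p + q = 1) (r0 : ℝ)
    (hr : r0 < 2*q) : ∃ m, r0 < uu p q m 0 := by
  have hp : 0 < p := by linarith
  have hmem := uu_mem p q hp.le hq0.le hpq
  have hmono := uu_mono p q hp.le hq0.le hpq
  have hlim : ∀ x, ∃ l, Tendsto (fun t => uu p q t x) atTop (nhds l) := fun x =>
    ⟨_, tendsto_atTop_ciSup (hmono x) ⟨1, by rintro _ ⟨t, rfl⟩; exact (hmem t x).2⟩⟩
  choose U hU using hlim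
  have hU0 : ∀ x, 0 ≤ U x := fun x => ge_of_tendsto' (hU x) (fun t => (hmem t x).1)
  let W : ℤ → ℝ := fun x => if x = 0 then 1 else U x
  have hW : ∀ x, Tendsto (fun t => if x = 0 then 1 else uu p q t x) atTop (nhds (W x)) := by
    intro x
    by_cases h : x = 0
    · simp [W, h]
    · simpa [W, h] using hU x
  have hW0 : ∀ x, 0 ≤ W x := by
    intro x; simp only [W]; split_ifs
    · simp
    · exact hU0 x
  have hrec : ∀ x, U x = p * W (x+1) + q * W (x + -1) := by
    intro x
    have h1 := (hU x).comp (tendsto_add_atTop_nat 1)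
    have h2 := ((hW (x+1)).const_mul p).add ((hW (x + -1)).const_mul q)
    exact tendsto_nhds_unique h1 h2
  have hWrec : ∀ x, x ≠ 0 → W x = p * W (x+1) + q * W (x + -1) := by
    intro x hx
    rw [← hrec x]; simp [W, hx]
  have hp1 : p = 1 - q := by linarith
  -- positive side
  have hpos : q / p ≤ W 1 := by
    have h := ruin_aux (fun j => W (j:ℤ)) p q hp (by simp [W]) (fun j => hW0 _) (by
      intro j
      have h := hWrec ((j:ℤ)+1) (by positivity)
      have e1 : (j:ℤ) + 1 + 1 = ((j+2 : ℕ) : ℤ) := by push_cast; ring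
      have e2 : (j:ℤ) + 1 + -1 = (j : ℤ) := by ring
      have e3 : (j:ℤ) + 1 = ((j+1 : ℕ) : ℤ) := by push_cast; ring
      rw [e1, e2, e3] at h
      have : (p + q) * W ((j+1 : ℕ) : ℤ) = p * W ((j+2 : ℕ) : ℤ) + q * W (j:ℤ) := by
        rw [hpq, one_mul]; exact h
      show p * (W ((j+1 : ℕ) : ℤ) - W ((j+2 : ℕ) : ℤ)) = q * (W (j:ℤ) - W ((j+1 : ℕ) : ℤ))
      linarith)
    have hlt : q / p < 1 := by rw [div_lt_one hp]; linarith
    have hs := (hasSum_geometric_of_lt_one (by positivity) hlt).tendsto_sum_nat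
    have := le_of_tendsto' (hs.const_mul (1 - W ((1:ℕ):ℤ))) h
    have h1 : 0 < 1 - q/p := by linarith
    rw [← div_eq_mul_inv, div_le_one h1] at this
    simp only [Nat.cast_one] at this
    linarith
  have hneg : 1 ≤ W (-1) := by
    have h := ruin_aux (fun j => W (-(j:ℤ))) q p hq0 (by simp [W]) (fun j => hW0 _) (by
      intro j
      have h := hWrec (-((j:ℤ)+1)) (by omega)
      have e1 : -((j:ℤ) + 1) + 1 = -(j : ℤ) := by ring
      have e2 : -((j:ℤ) + 1) + -1 = -((j+2 : ℕ) : ℤ) := by push_cast; ring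
      have e3 : (j:ℤ) + 1 = ((j+1 : ℕ) : ℤ) := by push_cast; ring
      rw [e1, e2, e3] at h
      have : (p + q) * W (-((j+1 : ℕ) : ℤ)) = p * W (-(j:ℤ)) + q * W (-((j+2 : ℕ) : ℤ)) := by
        rw [hpq, one_mul]; exact h
      show q * (W (-((j+1 : ℕ) : ℤ)) - W (-((j+2 : ℕ) : ℤ))) = p * (W (-(j:ℤ)) - W (-((j+1 : ℕ) : ℤ)))
      linarith)
    by_contra hc
    push Not at hc
    have hc' : 0 < 1 - W (-1) := by linarith
    have hr1 : 1 ≤ p / q := by rw [one_le_div hq0]; linarith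
    obtain ⟨N, hN⟩ := exists_nat_gt (1 / (1 - W (-1)))
    have h2 := h N
    have h3 : (N:ℝ) ≤ ∑ i ∈ Finset.range N, (p/q)^i := by
      calc (N:ℝ) = ∑ i ∈ Finset.range N, (1:ℝ) := by simp
        _ ≤ _ := Finset.sum_le_sum (fun i _ => one_le_pow₀ hr1)
    rw [div_lt_iff₀ hc'] at hN
    simp only [Nat.cast_one] at h2
    have := mul_le_mul_of_nonneg_left h3 hc'.le
    linarith
  have hU2 : 2 * q ≤ U 0 := by
    rw [hrec 0]
    simp only [zero_add]
    have h1 := mul_le_mul_of_nonneg_left hpos hp.le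
    have h2 := mul_le_mul_of_nonneg_left hneg hq0.le
    rw [mul_div_cancel₀ _ hp.ne'] at h1
    linarith
  exact ((hU 0).eventually (lt_mem_nhds (lt_of_lt_of_le hr hU2))).exists

lemma VV_nonneg (p q : ℝ) (hp : 0 ≤ p) (hq : 0 ≤ q) (hpq : p + q = 1) (k m : ℕ) (s) :
    0 ≤ VV p q k m s := by
  obtain ⟨b, r, t, x⟩ := s
  have h1 := uu_mem p q hp hq hpq t x
  have h2 := uu_mem p q hp hq hpq m 0
  cases r with
  | zero => simp [VV]
  | succ r =>
    simp only [VV]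
    apply mul_nonneg
    · have := mul_le_one₀ h1.2 (pow_nonneg h2.1 r) (pow_le_one₀ h2.1 h2.2)
      linarith
    · apply pow_nonneg
      have := pow_le_one₀ h2.1 h2.2 (n := k+1)
      linarith

lemma VV_step (p q : ℝ) (hpq : p + q = 1) (k m : ℕ) (s) :
    p * VV p q k m (stp k m s 1) + q * VV p q k m (stp k m s (-1)) = VV p q k m s := by
  obtain ⟨b, r, t, x⟩ := s
  have hp : p = 1 - q := by linarith
  rcases r with _ | r
  · simp [stp, VV]
  rcases t with _ | t
  · rcases b with _ | b
    · simp only [stp]; rw [← add_mul, hpq, one_mul]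
    · simp only [stp]; rw [← add_mul, hpq, one_mul]
      simp only [VV, uu]; ring
  · have key : ∀ e, VV p q k m (stp k m (b, r+1, t+1, x) e) =
        (1 - (if x + e = 0 then 1 else uu p q t (x+e)) * (uu p q m 0)^r) *
          (1 - (uu p q m 0)^(k+1))^b := by
      intro e
      simp only [stp]
      split_ifs with h
      · rcases r with _ | r
        · simp [VV]
        · simp only [VV]; ring
      · simp only [VV]
    rw [key, key]
    simp only [VV, uu]
    generalize (if x + 1 = 0 then 1 else uu p q t (x+1)) = A
    generalize (if x + -1 = 0 then 1 else uu p q t (x + -1)) = A'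
    rw [hp]; ring

/-- time potential -/
def tau (k m : ℕ) (s : ℕ × ℕ × ℕ × ℤ) : ℕ := s.1 * ((k+1)*m+1) + (s.2.1 - 1) * m + s.2.2.1

def done (s : ℕ × ℕ × ℕ × ℤ) : Prop := s.2.1 = 0 ∨ (s.1 = 0 ∧ s.2.2.1 = 0)

lemma stp_tau (k m : ℕ) (s) (e : ℤ) :
    (done s → stp k m s e = s) ∧ (¬ done s → done (stp k m s e) ∨
      tau k m (stp k m s e) + 1 ≤ tau k m s) := by
  obtain ⟨b, r, t, x⟩ := s
  rcases r with _ | r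
  · simp [stp, done]
  rcases t with _ | t
  · rcases b with _ | b
    · simp [stp, done]
    · simp only [stp, done, tau]
      refine ⟨by simp, fun _ => Or.inr ?_⟩
      simp only [Nat.add_sub_cancel]
      nlinarith [Nat.zero_le (r*m)]
  · refine ⟨by simp [done], fun _ => ?_⟩
    simp only [stp]
    split_ifs with h
    · rcases r with _ | r
      · left; simp [done]
      · right; simp only [tau, Nat.add_sub_cancel]; nlinarith
    · right; simp only [tau, Nat.add_sub_cancel]; omega

lemma stt_done (k m : ℕ) (s0) (x : ℕ → ℤ) (n : ℕ) :
    done (stt k m s0 x n) ∨ tau k m (stt k m s0 x n) + n ≤ tau k m s0 := by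
  induction n with
  | zero => right; simp [stt]
  | succ n ih =>
    simp only [stt]
    by_cases hd : done (stt k m s0 x n)
    · left; rw [(stp_tau k m _ _).1 hd]; exact hd
    · rcases (stp_tau k m (stt k m s0 x n) (x n)).2 hd with h | h
      · exact Or.inl h
      · right
        rcases ih with ih | ih
        · exact absurd ih hd
        · omega

lemma localTime_succ (X : ℕ → Ω → ℤ) (z : ℤ) (n : ℕ) (ω : Ω) :
    localTime X z (n+1) ω = localTime X z n ω + if S X (n+1) ω = z then 1 else 0 := by
  unfold localTime
  rw [← Finset.insert_Icc_right_eq_Icc_add_one (by omega), Finset.filter_insert]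
  split_ifs with h
  · rw [Finset.card_insert_of_notMem (by simp)]
  · rfl

lemma stt_inv (X : ℕ → Ω → ℤ) (ω : Ω) (k m B n : ℕ) :
    ∃ z, (¬ done (stt k m (B, k+1, 0, 0) (fun i => X i ω) n) →
        (stt k m (B, k+1, 0, 0) (fun i => X i ω) n).2.2.2 = S X n ω - z) ∧
      k + 1 ≤ (stt k m (B, k+1, 0, 0) (fun i => X i ω) n).2.1 + localTime X z n ω := by
  induction n with
  | zero => exact ⟨0, by simp [stt, S], by simp [stt]⟩
  | succ n ih =>
    obtain ⟨z, h1, h2⟩ := ih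
    simp only [stt]
    generalize stt k m (B, k+1, 0, 0) (fun i => X i ω) n = s at *
    have hS : S X (n+1) ω = S X n ω + X n ω := by simp [S, Finset.sum_range_succ]
    by_cases hd : done s
    · rw [(stp_tau k m _ _).1 hd]
      refine ⟨z, fun h => absurd hd h, ?_⟩
      rw [localTime_succ]; omega
    · have h1 := h1 hd
      obtain ⟨b, r, t, x⟩ := s
      rcases r with _ | r
      · simp [done] at hd
      rcases t with _ | t
      · rcases b with _ | b
        · simp [done] at hd
        · exact ⟨S X (n+1) ω, by simp [stp], by simp [stp]⟩
      · refine ⟨z, ?_⟩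
        simp only at h1 h2
        simp only [stp]
        split_ifs with h
        · have : S X (n+1) ω = z := by omega
          rw [localTime_succ, if_pos this]
          refine ⟨fun _ => ?_, ?_⟩
          · simp only; omega
          · simp only; omega
        · rw [localTime_succ]
          refine ⟨fun _ => ?_, ?_⟩
          · simp only; omega
          · simp only; omega

lemma localTime_le_max (X : ℕ → Ω → ℤ) (z : ℤ) (n : ℕ) (ω : Ω) :
    localTime X z n ω ≤ maxLocalTime X n ω := by
  apply le_csSup
  · refine ⟨n, ?_⟩
    rintro _ ⟨z, rfl⟩
    simp only [localTime]
    exact (Finset.card_filter_le _ _).trans (by simp)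
  · exact ⟨z, rfl⟩

lemma VV_fail (p q : ℝ) (X : ℕ → Ω → ℤ) (ω : Ω) (k m B n : ℕ)
    (hn : tau k m (B, k+1, 0, 0) < n) (h : maxLocalTime X n ω < k + 1) :
    VV p q k m (stt k m (B, k+1, 0, 0) (fun i => X i ω) n) = 1 := by
  obtain ⟨z, -, h2⟩ := stt_inv X ω k m B n
  have h3 := stt_done k m (B, k+1, 0, 0) (fun i => X i ω) n
  have h4 := localTime_le_max X z n ω
  generalize stt k m (B, k+1, 0, 0) (fun i => X i ω) n = s at *
  obtain ⟨b, r, t, x⟩ := s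
  rcases h3 with h3 | h3
  · rcases h3 with h3 | ⟨h3, h5⟩
    · simp only at h3 h2; omega
    · simp only at h3 h5 h2
      subst h3 h5
      rcases r with _ | r
      · omega
      · simp [VV, uu]
  · omega

lemma stt_congr (k m : ℕ) (s0) (x y : ℕ → ℤ) (n : ℕ) (h : ∀ i < n, x i = y i) :
    stt k m s0 x n = stt k m s0 y n := by
  induction n with
  | zero => rfl
  | succ n ih =>
    simp only [stt]
    rw [ih (fun i hi => h i (by omega)), h n (by omega)]

lemma stt_indep [MeasurableSpace Ω] (P : Measure Ω) [IsProbabilityMeasure P]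
    (X : ℕ → Ω → ℤ) (hm : ∀ i, Measurable (X i)) (hi : iIndepFun X P) (k m : ℕ) (s0) (n : ℕ) :
    Measurable (fun ω => stt k m s0 (fun i => X i ω) n) ∧
    IndepFun (fun ω => stt k m s0 (fun i => X i ω) n) (X n) P := by
  let Ψ : (Finset.range n → ℤ) → ℕ × ℕ × ℕ × ℤ := fun v =>
    stt k m s0 (fun i => if h : i ∈ Finset.range n then v ⟨i, h⟩ else 0) n
  have hΨ : Measurable Ψ := measurable_of_countable _
  have he : (fun ω => stt k m s0 (fun i => X i ω) n) =
      Ψ ∘ (fun ω (i : Finset.range n) => X i ω) := by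
    funext ω
    apply stt_congr
    intro i hi
    simp [hi]
  have h1 := hi.indepFun_finset (Finset.range n) {n} (by simp) hm
  let Φ : (({n} : Finset ℕ) → ℤ) → ℤ := fun v => v ⟨n, by simp⟩
  have hΦ : Measurable Φ := measurable_of_countable _
  rw [he]
  refine ⟨hΨ.comp (measurable_pi_lambda _ (fun i => hm i)), ?_⟩
  exact h1.comp hΨ hΦ

lemma lint_step [MeasurableSpace Ω] (P : Measure Ω) [IsProbabilityMeasure P]
    (X : ℕ → Ω → ℤ) (p q : ℝ) (hp : 0 ≤ p) (hq : 0 ≤ q) (hpq : p + q = 1)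
    (hX : IsAsymmetricSRW P X p q) (k m : ℕ) (s0) (n : ℕ) :
    ∫⁻ ω, ENNReal.ofReal (VV p q k m (stt k m s0 (fun i => X i ω) (n+1))) ∂P =
    ∫⁻ ω, ENNReal.ofReal (VV p q k m (stt k m s0 (fun i => X i ω) n)) ∂P := by
  obtain ⟨hm, hi, h1, h2⟩ := hX
  obtain ⟨hmS, hind⟩ := stt_indep P X hm hi k m s0 n
  have hnn := VV_nonneg p q hp hq hpq k m
  have mg : ∀ e : ℤ, Measurable (fun s => ENNReal.ofReal (VV p q k m (stp k m s e))) :=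
    fun e => measurable_of_countable _
  have mi : ∀ e : ℤ, Measurable (fun y : ℤ => if y = e then (1:ℝ≥0∞) else 0) :=
    fun e => measurable_of_countable _
  have hsing : ∀ e : ℤ, MeasurableSet {ω | X n ω = e} := fun e =>
    hm n (measurableSet_singleton e)
  have hae : ∀ᵐ ω ∂P, X n ω = 1 ∨ X n ω = -1 := by
    have hu : P ({ω | X n ω = 1} ∪ {ω | X n ω = -1}) = 1 := by
      rw [measure_union _ (hsing _), h1, h2, ← ENNReal.ofReal_add hp hq, hpq, ENNReal.ofReal_one]
      rw [Set.disjoint_left]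
      intro ω (ha : _ = _) (hb : _ = _)
      omega
    have := (prob_compl_eq_zero_iff ((hsing 1).union (hsing (-1)))).2 hu
    rw [ae_iff]
    convert this using 2
    ext ω; simp
  set s : Ω → ℕ × ℕ × ℕ × ℤ := fun ω => stt k m s0 (fun i => X i ω) n with hs
  have hsplit : ∀ᵐ ω ∂P, ENNReal.ofReal (VV p q k m (stt k m s0 (fun i => X i ω) (n+1))) =
      (if X n ω = 1 then (1:ℝ≥0∞) else 0) * ENNReal.ofReal (VV p q k m (stp k m (s ω) 1)) +
      (if X n ω = -1 then (1:ℝ≥0∞) else 0) * ENNReal.ofReal (VV p q k m (stp k m (s ω) (-1))) := by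
    filter_upwards [hae] with ω hω
    rcases hω with h | h
    · simp [stt, h, hs]
    · simp [stt, h, hs]
  have hfac : ∀ e : ℤ, ∫⁻ ω, (if X n ω = e then (1:ℝ≥0∞) else 0) *
        ENNReal.ofReal (VV p q k m (stp k m (s ω) e)) ∂P =
      P {ω | X n ω = e} * ∫⁻ ω, ENNReal.ofReal (VV p q k m (stp k m (s ω) e)) ∂P := by
    intro e
    have h := lintegral_mul_eq_lintegral_mul_lintegral_of_indepFun
      ((mi e).comp (hm n)) ((mg e).comp hmS) (hind.symm.comp (mi e) (mg e))
    have h' : ∫⁻ ω, (if X n ω = e then (1:ℝ≥0∞) else 0) ∂P = P {ω | X n ω = e} := by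
      rw [← lintegral_indicator_one (hsing e)]
      apply lintegral_congr
      intro ω
      simp [Set.indicator]
    rw [← h']
    exact h
  have mgs : ∀ e : ℤ, Measurable (fun ω => ENNReal.ofReal (VV p q k m (stp k m (s ω) e))) :=
    fun e => (mg e).comp hmS
  rw [lintegral_congr_ae hsplit, lintegral_add_left, hfac, hfac, h1, h2,
    ← lintegral_const_mul _ (mgs 1), ← lintegral_const_mul _ (mgs (-1)),
    ← lintegral_add_left ((mgs 1).const_mul _)]
  · apply lintegral_congr
    intro ω
    rw [← ENNReal.ofReal_mul hp, ← ENNReal.ofReal_mul hq,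
      ← ENNReal.ofReal_add (mul_nonneg hp (hnn _)) (mul_nonneg hq (hnn _)), VV_step p q hpq]
  · exact ((mi 1).comp (hm n)).mul ((mg 1).comp hmS)

lemma main_bound [MeasurableSpace Ω] (P : Measure Ω) [IsProbabilityMeasure P]
    (X : ℕ → Ω → ℤ) (p q : ℝ) (hp : 0 ≤ p) (hq : 0 ≤ q) (hpq : p + q = 1)
    (hX : IsAsymmetricSRW P X p q) (k m B n : ℕ) (hn : tau k m (B, k+1, 0, 0) < n) :
    P {ω | maxLocalTime X n ω < k + 1} ≤
      ENNReal.ofReal ((1 - (uu p q m 0)^(k+1))^B) := by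
  have hE : ∀ j, ∫⁻ ω, ENNReal.ofReal (VV p q k m (stt k m (B, k+1, 0, 0) (fun i => X i ω) j)) ∂P
      = ENNReal.ofReal ((1 - (uu p q m 0)^(k+1))^B) := by
    intro j
    induction j with
    | zero => simp [stt, VV, uu]
    | succ j ih => rw [lint_step P X p q hp hq hpq hX, ih]
  rw [← hE n]
  have hmeas : Measurable (fun ω =>
      ENNReal.ofReal (VV p q k m (stt k m (B, k+1, 0, 0) (fun i => X i ω) n))) :=
    (measurable_of_countable (fun s => ENNReal.ofReal (VV p q k m s))).comp
      (stt_indep P X hX.1 hX.2.1 k m _ n).1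
  have := mul_meas_ge_le_lintegral (μ := P) hmeas 1
  rw [one_mul] at this
  refine le_trans (measure_mono ?_) this
  intro ω hω
  simp only [Set.mem_ofPred_eq] at hω ⊢
  rw [VV_fail p q X ω k m B n hn hω]; simp

lemma asymp (c γ α r0 : ℝ) (m : ℕ) (hc : 0 < c) (hr : 0 < r0) (hγ : 0 < γ) (hα : 0 < α)
    (h : γ + α < 1) :
    ∀ᶠ n : ℕ in atTop, (n:ℝ)^α ≤
      ((n:ℝ) / ((c * Real.log n + 1) * m + 1) - 2) * (r0 * (n:ℝ)^(-γ)) := by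
  set η := 1 - γ - α with hη
  have hη0 : 0 < η := by linarith
  -- denominators
  have hlog : Tendsto (fun n : ℕ => ((c * Real.log n + 1) * m + 1) / (n:ℝ)^η) atTop (nhds 0) := by
    have h1 : Tendsto (fun x : ℝ => Real.log x / x^η) atTop (nhds 0) :=
      (isLittleO_log_rpow_atTop hη0).tendsto_div_nhds_zero
    have h2 : Tendsto (fun x : ℝ => 1 / x^η) atTop (nhds 0) := by
      simp only [one_div]
      exact (tendsto_rpow_atTop hη0).inv_tendsto_atTop
    have h3 := ((h1.const_mul (c * m)).add (h2.const_mul ((m:ℝ)+1))).comp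
      (tendsto_natCast_atTop_atTop (R := ℝ))
    simp only [mul_zero, add_zero] at h3
    refine h3.congr (fun n => ?_)
    simp only [Function.comp]
    ring
  have hK : 0 < 1 / (1 / r0 + 2) := by positivity
  filter_upwards [hlog.eventually (gt_mem_nhds hK), eventually_ge_atTop 1] with n hn hn1
  have hx : (1:ℝ) ≤ n := by exact_mod_cast hn1
  have hx0 : (0:ℝ) < n := by linarith
  set D := (c * Real.log n + 1) * m + 1 with hD
  have hD0 : 0 < D := by
    have := Real.log_nonneg hx
    positivity
  have hp : 0 < (n:ℝ)^η := Real.rpow_pos_of_pos hx0 _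
  rw [div_lt_div_iff₀ hp (by positivity), one_mul] at hn
  have h5 : 1 / r0 + 2 ≤ (n:ℝ)^η / D := by
    rw [le_div_iff₀ hD0]; linarith
  have e1 : (n:ℝ) = (n:ℝ)^η * (n:ℝ)^(γ+α) := by
    rw [← Real.rpow_add hx0, hη]; ring_nf; simp
  have h6 : (1:ℝ) ≤ (n:ℝ)^(γ+α) := Real.one_le_rpow hx (by linarith)
  have e2 : (n:ℝ)/D = (n:ℝ)^η / D * (n:ℝ)^(γ+α) := by
    rw [div_mul_eq_mul_div, ← e1]
  have h7 : 1/r0 * (n:ℝ)^(γ+α) ≤ (n:ℝ)/D - 2 := by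
    rw [e2]; nlinarith
  have h8 : 0 < r0 * (n:ℝ)^(-γ) := by positivity
  calc (n:ℝ)^α = (1/r0 * (n:ℝ)^(γ+α)) * (r0 * (n:ℝ)^(-γ)) := by
        have : (n:ℝ)^α = (n:ℝ)^(γ+α) * (n:ℝ)^(-γ) := by
          rw [← Real.rpow_add hx0]; ring_nf
        rw [this]; field_simp
    _ ≤ _ := mul_le_mul_of_nonneg_right h7 h8.le

/-- For every `ε ∈ (0,1)` and every `α ∈ (0, ε/2)`, for all sufficiently large `n`,
`P(ξ(n) ≤ (1-ε/2) λ log n) ≤ exp(-n^α)`. -/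
theorem maxLocalTime_lower_tail
    [MeasurableSpace Ω] (P : Measure Ω) [IsProbabilityMeasure P]
    (X : ℕ → Ω → ℤ) (p q : ℝ) (hq0 : 0 < q) (hq : q < 1/2) (hpq : p + q = 1)
    (hX : IsAsymmetricSRW P X p q)
    (lam : ℝ) (hlam : lam = -1 / Real.log (2*q))
    (ε α : ℝ) (hε : ε ∈ Set.Ioo (0:ℝ) 1) (hα : α ∈ Set.Ioo (0:ℝ) (ε/2)) :
    ∃ N : ℕ, ∀ n : ℕ, N ≤ n →
      P {ω | (maxLocalTime X n ω : ℝ) ≤ (1 - ε/2) * lam * Real.log n}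
        ≤ ENNReal.ofReal (Real.exp (-(n : ℝ) ^ α)) := by
  have hp : 0 < p := by linarith
  obtain ⟨hε0, hε1⟩ := hε
  obtain ⟨hα0, hα1⟩ := hα
  have hlog : Real.log (2*q) < 0 := Real.log_neg (by linarith) (by linarith)
  have hlam0 : 0 < lam := by rw [hlam]; exact div_pos_of_neg_of_neg (by norm_num) hlog
  set c := (1 - ε/2) * lam with hc
  have hc0 : 0 < c := mul_pos (by linarith) hlam0
  set γ := ((1 - ε/2) + (1 - α)) / 2 with hγ
  have hγ0 : 0 < γ := by rw [hγ]; linarith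
  have hγα : γ + α < 1 := by rw [hγ]; linarith
  set r0 := Real.exp (-γ / c) with hr0
  have hr0p : 0 < r0 := Real.exp_pos _
  have hr : r0 < 2 * q := by
    rw [hr0, ← Real.lt_log_iff_exp_lt (by linarith), div_lt_iff₀ hc0, hc, hlam]
    have : Real.log (2*q) * ((1 - ε/2) * (-1 / Real.log (2*q))) = -(1 - ε/2) := by
      have := hlog.ne
      field_simp
    rw [this, hγ]; linarith
  obtain ⟨m, hm⟩ := uu_large p q hq0 hq hpq r0 hr
  have hu := uu_mem p q hp.le hq0.le hpq m 0
  obtain ⟨N, hN⟩ := eventually_atTop.1 (asymp c γ α r0 m hc0 hr0p hγ0 hα0 hγα)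
  refine ⟨N + 1, fun n hn => ?_⟩
  have hA := hN n (by omega)
  have hx : (1:ℝ) ≤ n := by exact_mod_cast (by omega : 1 ≤ n)
  have hx0 : (0:ℝ) < n := by linarith
  have hl0 := Real.log_nonneg hx
  set k := ⌊c * Real.log n⌋₊ with hk
  have hk1 : (k:ℝ) ≤ c * Real.log n := Nat.floor_le (by positivity)
  have hk2 : c * Real.log n < k + 1 := Nat.lt_floor_add_one _
  set D := (k+1)*m+1 with hD
  have hsub : {ω | (maxLocalTime X n ω : ℝ) ≤ c * Real.log n} ⊆
      {ω | maxLocalTime X n ω < k + 1} := by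
    intro ω hω
    have : (maxLocalTime X n ω : ℝ) < k + 1 := lt_of_le_of_lt hω hk2
    exact_mod_cast this
  have hppos : 0 < r0 * (n:ℝ)^(-γ) := by positivity
  have hDle : (D:ℝ) ≤ (c * Real.log n + 1) * m + 1 := by
    rw [hD]; push_cast
    have : (0:ℝ) ≤ m := by positivity
    nlinarith
  have hDpos : (0:ℝ) < D := by rw [hD]; positivity
  have hnD : (n:ℝ) / ((c * Real.log n + 1) * m + 1) ≤ (n:ℝ) / D :=
    div_le_div_of_nonneg_left hx0.le hDpos hDle
  have hfl : (n:ℝ) / D < (n / D : ℕ) + 1 := by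
    rw [← Nat.floor_div_eq_div (K := ℝ)]
    exact Nat.lt_floor_add_one _
  have hB1 : 1 ≤ n / D := by
    by_contra hcon
    have h0 : n / D = 0 := Nat.lt_one_iff.1 (not_le.1 hcon)
    rw [h0] at hfl
    have hneg : (n:ℝ) / ((c * Real.log n + 1) * m + 1) - 2 < 0 := by
      push_cast at hfl; linarith
    have h1 := mul_neg_of_neg_of_pos hneg hppos
    have h2 : 0 < (n:ℝ)^α := by positivity
    linarith
  obtain ⟨B, hB⟩ : ∃ B, n / D = B + 1 := ⟨n/D - 1, (Nat.sub_add_cancel hB1).symm⟩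
  have htau : tau k m (B, k+1, 0, 0) < n := by
    have h1 : (B+1) * D ≤ n := by rw [← hB]; exact Nat.div_mul_le_self n D
    simp only [tau, Nat.add_sub_cancel]
    rw [← hD]
    nlinarith
  refine (measure_mono hsub).trans ((main_bound P X p q hp.le hq0.le hpq hX k m B n htau).trans ?_)
  apply ENNReal.ofReal_le_ofReal
  have hBr : (n:ℝ) / ((c * Real.log n + 1) * m + 1) - 2 ≤ B := by
    rw [hB] at hfl; push_cast at hfl; linarith
  have hfk : r0 * (n:ℝ)^(-γ) ≤ (uu p q m 0)^(k+1) := by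
    have h1 : r0^(k+1) ≤ (uu p q m 0)^(k+1) := pow_le_pow_left₀ hr0p.le hm.le _
    refine le_trans ?_ h1
    rw [pow_succ, mul_comm]
    refine mul_le_mul_of_nonneg_right ?_ hr0p.le
    rw [Real.rpow_def_of_pos hx0, hr0, ← Real.exp_nat_mul, Real.exp_le_exp]
    have : (k:ℝ) * (-γ / c) = -(γ / c) * k := by ring
    rw [this]
    have h3 : (γ/c) * k ≤ (γ/c) * (c * Real.log n) :=
      mul_le_mul_of_nonneg_left hk1 (by positivity)
    have h4 : (γ/c) * (c * Real.log n) = Real.log n * γ := by field_simp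
    linarith
  have hle1 : (uu p q m 0)^(k+1) ≤ 1 := pow_le_one₀ hu.1 hu.2
  have hexp : 1 - (uu p q m 0)^(k+1) ≤ Real.exp (-(uu p q m 0)^(k+1)) := by
    have := Real.add_one_le_exp (-(uu p q m 0)^(k+1)); linarith
  calc (1 - (uu p q m 0)^(k+1))^B ≤ (Real.exp (-(uu p q m 0)^(k+1)))^B :=
        pow_le_pow_left₀ (by linarith) hexp _
    _ = Real.exp (B * (-(uu p q m 0)^(k+1))) := by rw [← Real.exp_nat_mul]
    _ ≤ Real.exp (-(n:ℝ)^α) := by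
        rw [Real.exp_le_exp]
        have h1 := mul_le_mul_of_nonneg_right hBr hppos.le
        have h2 := mul_le_mul_of_nonneg_left hfk (Nat.cast_nonneg (α := ℝ) B)
        linarith
end

section
/- Let ε ∈ (0,1) satisfy (1 + δ)(1 - ε)^2 > 1 + δ/2. Then almost surely the event D_n^ε ∩ E_n^ε occurs eventually, i.e. P(∃ N such that D_n^ε ∩ E_n^ε holds for all n ≥ N) = 1. -/
open MeasureTheory ProbabilityTheory Filter Set
open scoped ENNReal NNReal

variable {Ω : Type*}

open scoped Classical in
/-- The pair count `F_{a,b}`: the number of pairs `1 ≤ i < j ≤ ⌊a⌋` with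
`j ≤ (i + 2λ log a) ∧ ⌊a⌋`, such that both `S_i` and `S_j` have local time at least
`(1-ε) λ log b` at time `⌊a⌋`, neither `S_i` nor `S_j` occurs strictly between times
`i` and `j`, and `S_i ≠ S_j`.  Here `λ = -1/log(2q)`. -/
noncomputable def Fcount (q : ℝ) (X : ℕ → Ω → ℤ) (ε : ℝ) (a b : ℝ) (ω : Ω) : ℕ :=
  ∑ i ∈ Finset.Icc 1 ⌊a⌋₊,
    ∑ j ∈ Finset.Icc (i + 1) (min ⌊(i : ℝ) + 2 * (-1 / Real.log (2*q)) * Real.log a⌋₊ ⌊a⌋₊),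
      if ((1 - ε) * (-1 / Real.log (2*q)) * Real.log b
            ≤ min (localTime X (S X i ω) ⌊a⌋₊ ω : ℝ) (localTime X (S X j ω) ⌊a⌋₊ ω)
          ∧ (∀ l : ℕ, i < l → l < j → S X l ω ≠ S X i ω ∧ S X l ω ≠ S X j ω)
          ∧ S X i ω ≠ S X j ω) then 1 else 0

/-- The event `D_n^ε = {(1-ε/2) λ log n ≤ ξ(n) ≤ 2(1+ε/2) λ log n}`. -/
noncomputable def Dset (q : ℝ) (X : ℕ → Ω → ℤ) (ε : ℝ) (n : ℕ) : Set Ω :=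
  {ω | (1 - ε/2) * (-1 / Real.log (2*q)) * Real.log n ≤ (maxLocalTime X n ω : ℝ)
        ∧ (maxLocalTime X n ω : ℝ) ≤ 2 * (1 + ε/2) * (-1 / Real.log (2*q)) * Real.log n}

/-- The event `E_n^ε = {F_n = 0}`, i.e. there is no pair of nearby thick points
before time `n`. -/
noncomputable def Eset (q : ℝ) (X : ℕ → Ω → ℤ) (ε : ℝ) (n : ℕ) : Set Ω :=
  {ω | Fcount q X ε (n : ℝ) (n : ℝ) ω = 0}

/-- The past sigma-algebra generated by `X 0, …, X (n-1)`. -/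
@[reducible] def pastSig (X : ℕ → Ω → ℤ) (n : ℕ) : MeasurableSpace Ω :=
  ⨆ j ∈ Set.Iio n, MeasurableSpace.comap (X j) inferInstance

lemma pastSig_le [m : MeasurableSpace Ω] {X : ℕ → Ω → ℤ} (h : ∀ i, Measurable (X i)) (n : ℕ) :
    pastSig X n ≤ m :=
  iSup₂_le fun j _ => (h j).comap_le

lemma pastSig_mono (X : ℕ → Ω → ℤ) {a b : ℕ} (h : a ≤ b) : pastSig X a ≤ pastSig X b :=
  iSup₂_le fun j hj => le_iSup₂_of_le j (lt_of_lt_of_le hj h) le_rfl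

lemma meas_X_past (X : ℕ → Ω → ℤ) {j n : ℕ} (h : j < n) : Measurable[pastSig X n] (X j) := by
  have : MeasurableSpace.comap (X j) inferInstance ≤ pastSig X n :=
    le_iSup₂_of_le (f := fun j (_ : j ∈ Set.Iio n) => MeasurableSpace.comap (X j) inferInstance)
      j h le_rfl
  exact fun s hs => this _ ⟨s, hs, rfl⟩

lemma meas_S_past (X : ℕ → Ω → ℤ) {j n : ℕ} (h : j ≤ n) : Measurable[pastSig X n] (S X j) := by
  unfold S
  refine Finset.measurable_fun_sum _ fun i hi => meas_X_past X ?_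
  have := Finset.mem_range.1 hi; omega

lemma one_step [MeasurableSpace Ω] {P : Measure Ω} [IsProbabilityMeasure P]
    {X : ℕ → Ω → ℤ} {p q : ℝ} (hq0 : 0 < q) (hp0 : 0 < p) (hpq : p + q = 1)
    (hX : IsAsymmetricSRW P X p q) : ∀ᵐ ω ∂P, ∀ n, X n ω = 1 ∨ X n ω = -1 := by
  obtain ⟨hm, hi, h1, h2⟩ := hX
  rw [ae_all_iff]
  intro n
  have hA : MeasurableSet {ω | X n ω = 1} := hm n (measurableSet_singleton 1)
  have hB : MeasurableSet {ω | X n ω = -1} := hm n (measurableSet_singleton (-1))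
  have hd : Disjoint {ω | X n ω = 1} {ω | X n ω = -1} := by
    rw [Set.disjoint_left]; intro ω h h'; simp only [Set.mem_ofPred_eq] at h h'; omega
  have : P ({ω | X n ω = 1} ∪ {ω | X n ω = -1}) = 1 := by
    rw [measure_union hd hB, h1, h2, ← ENNReal.ofReal_add hp0.le hq0.le, hpq, ENNReal.ofReal_one]
  exact (mem_ae_iff_prob_eq_one (hA.union hB)).2 this

lemma step_int [MeasurableSpace Ω] {P : Measure Ω} [IsProbabilityMeasure P]
    {X : ℕ → Ω → ℤ} {p q : ℝ} (hq0 : 0 < q) (hp0 : 0 < p) (hpq : p + q = 1)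
    (hX : IsAsymmetricSRW P X p q) (n : ℕ) (F : ℤ → Ω → ℝ≥0∞)
    (hF1 : Measurable[pastSig X n] (F 1)) (hF2 : Measurable[pastSig X n] (F (-1))) :
    ∫⁻ ω, F (X n ω) ω ∂P =
      ∫⁻ ω, (ENNReal.ofReal p * F 1 ω + ENNReal.ofReal q * F (-1) ω) ∂P := by
  have hae := one_step hq0 hp0 hpq hX
  obtain ⟨hm, hi, h1, h2⟩ := hX
  have hind : Indep (pastSig X n) (MeasurableSpace.comap (X n) inferInstance) P := by
    have := indep_iSup_of_disjoint (fun j => (hm j).comap_le) hi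
      (S := Set.Iio n) (T := {n}) (by simp)
    simpa [pastSig] using this
  have key : ∀ (a : ℤ) (f : Ω → ℝ≥0∞), Measurable[pastSig X n] f →
      ∫⁻ ω, f ω * (X n ⁻¹' {a}).indicator 1 ω ∂P = P {ω | X n ω = a} * ∫⁻ ω, f ω ∂P := by
    intro a f hf
    have hmi : Measurable[MeasurableSpace.comap (X n) inferInstance]
        ((X n ⁻¹' {a}).indicator (1 : Ω → ℝ≥0∞)) :=
      Measurable.indicator measurable_const ⟨{a}, measurableSet_singleton a, rfl⟩
    rw [lintegral_mul_eq_lintegral_mul_lintegral_of_independent_measurableSpace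
      (pastSig_le hm n) (hm n).comap_le hind hf hmi]
    rw [lintegral_indicator_one (hm n (measurableSet_singleton a)), mul_comm]
    rfl
  have e : ∫⁻ ω, F (X n ω) ω ∂P = ∫⁻ ω, (F 1 ω * (X n ⁻¹' {1}).indicator 1 ω +
      F (-1) ω * (X n ⁻¹' {-1}).indicator 1 ω) ∂P := by
    apply lintegral_congr_ae
    filter_upwards [hae] with ω hω
    rcases hω n with h | h <;> simp [h]
  have m1 : Measurable (F 1) := hF1.mono (pastSig_le hm n) le_rfl
  have m2 : Measurable (F (-1)) := hF2.mono (pastSig_le hm n) le_rfl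
  have m3 : Measurable (fun ω => F 1 ω * (X n ⁻¹' {1}).indicator 1 ω) :=
    m1.mul (measurable_one.indicator (hm n (measurableSet_singleton 1)))
  rw [e, lintegral_add_left m3,
    key 1 _ hF1, key (-1) _ hF2, h1, h2, lintegral_add_left (m1.const_mul _),
    lintegral_const_mul _ m1, lintegral_const_mul _ m2]

/-- Visits of `S_{i+l} - S_i` to `A` for `l < t`. -/
noncomputable def Nv (X : ℕ → Ω → ℤ) (A : Finset ℤ) (i t : ℕ) (ω : Ω) : ℕ :=
  ((Finset.range t).filter (fun l => S X (i + l) ω - S X i ω ∈ A)).card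

lemma Nv_succ (X : ℕ → Ω → ℤ) (A : Finset ℤ) (i t : ℕ) (ω : Ω) :
    Nv X A i (t + 1) ω = Nv X A i t ω + if S X (i + t) ω - S X i ω ∈ A then 1 else 0 := by
  unfold Nv
  rw [Finset.range_add_one, Finset.filter_insert]
  split_ifs with h
  · rw [Finset.card_insert_of_notMem (by simp)]
  · rfl

lemma meas_Nv (X : ℕ → Ω → ℤ) (A : Finset ℤ) (i t : ℕ) :
    Measurable[pastSig X (i + t)] (Nv X A i t) := by
  induction t with
  | zero =>
    have : Nv X A i 0 = fun _ => 0 := by funext ω; simp [Nv]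
    rw [this]; exact measurable_const
  | succ t ih =>
    have : Nv X A i (t + 1) = fun ω => Nv X A i t ω +
        (fun z : ℤ => if z ∈ A then 1 else 0) (S X (i + t) ω - S X i ω) := by
      funext ω; exact Nv_succ X A i t ω
    rw [this]
    have hs : Measurable[pastSig X (i + (t+1))] (fun ω => S X (i + t) ω - S X i ω) :=
      (meas_S_past X (by omega)).sub (meas_S_past X (by omega))
    refine Measurable.add (ih.mono (pastSig_mono X (by omega)) le_rfl) ?_
    exact (measurable_of_countable (fun z : ℤ => if z ∈ A then 1 else 0)).comp hs

lemma S_succ (X : ℕ → Ω → ℤ) (n : ℕ) (ω : Ω) : S X (n + 1) ω = S X n ω + X n ω := by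
  simp [S, Finset.sum_range_succ]

lemma chain_step [MeasurableSpace Ω] {P : Measure Ω} [IsProbabilityMeasure P]
    {X : ℕ → Ω → ℤ} {p q : ℝ} (hq0 : 0 < q) (hp0 : 0 < p) (hpq : p + q = 1)
    (hX : IsAsymmetricSRW P X p q) (A : Finset ℤ) (i t : ℕ) (G : Set Ω)
    (hG : MeasurableSet[pastSig X i] G) (Φ : ℤ → ℕ → ℝ) (hΦ : ∀ x c, 0 ≤ Φ x c) :
    ∫⁻ ω in G, ENNReal.ofReal (Φ (S X (i + (t + 1)) ω - S X i ω) (Nv X A i (t + 1) ω)) ∂P =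
    ∫⁻ ω in G, ENNReal.ofReal
      (p * Φ (S X (i + t) ω - S X i ω + 1)
          (Nv X A i t ω + if S X (i + t) ω - S X i ω ∈ A then 1 else 0)
       + q * Φ (S X (i + t) ω - S X i ω - 1)
          (Nv X A i t ω + if S X (i + t) ω - S X i ω ∈ A then 1 else 0)) ∂P := by
  have hGm : MeasurableSet G := pastSig_le hX.1 i _ hG
  rw [← lintegral_indicator hGm, ← lintegral_indicator hGm]
  let F : ℤ → Ω → ℝ≥0∞ := fun z => G.indicator (fun ω =>
    ENNReal.ofReal (Φ (S X (i + t) ω - S X i ω + z)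
          (Nv X A i t ω + if S X (i + t) ω - S X i ω ∈ A then 1 else 0)))
  have hFm : ∀ z, Measurable[pastSig X (i + t)] (F z) := by
    intro z
    refine Measurable.indicator ?_ (pastSig_mono X (by omega) _ hG)
    have hs : Measurable[pastSig X (i + t)] (fun ω => S X (i + t) ω - S X i ω) :=
      (meas_S_past X (by omega)).sub (meas_S_past X (by omega))
    have hpair := hs.prodMk (meas_Nv X A i t)
    exact (measurable_of_countable (fun y : ℤ × ℕ => ENNReal.ofReal (Φ (y.1 + z)
          (y.2 + if y.1 ∈ A then 1 else 0)))).comp hpair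
  have := step_int hq0 hp0 hpq hX (i + t) F (hFm 1) (hFm (-1))
  convert this using 1
  · apply lintegral_congr
    intro ω
    simp only [F, Set.indicator]
    split_ifs with h
    · rw [Nv_succ, ← add_assoc, S_succ]; congr 2
      · ring
      · rw [if_pos ‹_›]
    · rw [Nv_succ, ← add_assoc, S_succ]; congr 2
      · ring
      · rw [if_neg ‹_›]
    · rfl
  · apply lintegral_congr
    intro ω
    by_cases h : ω ∈ G
    · simp only [F, Set.indicator_of_mem h]
      rw [ENNReal.ofReal_add (mul_nonneg hp0.le (hΦ _ _)) (mul_nonneg hq0.le (hΦ _ _)),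
        ENNReal.ofReal_mul hp0.le, ENNReal.ofReal_mul hq0.le, ← sub_eq_add_neg]
    · simp [F, Set.indicator_of_notMem h]

/-- Probability of ever hitting `0` from `x`. -/
noncomputable def hv (s : ℝ) (x : ℤ) : ℝ := if x ≤ 0 then 1 else (s ^ 2) ^ x.toNat

lemma hv_pos {s : ℝ} (hs : 0 < s) (x : ℤ) : 0 < hv s x := by
  unfold hv; split_ifs <;> positivity

lemma hv_le_one {s : ℝ} (hs : 0 < s) (hs1 : s < 1) (x : ℤ) : hv s x ≤ 1 := by
  unfold hv; split_ifs
  · exact le_rfl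
  · exact pow_le_one₀ (by positivity) (by nlinarith)

lemma hv_nonpos (s : ℝ) {x : ℤ} (h : x ≤ 0) : hv s x = 1 := by simp [hv, h]

lemma hv_nat (s : ℝ) (n : ℕ) : hv s (n : ℤ) = (s ^ 2) ^ n := by
  unfold hv; split_ifs with h
  · have : n = 0 := by omega
    simp [this]
  · simp

lemma hv_harm {s p q : ℝ} (hps : q = p * s ^ 2) (hpq : p + q = 1) {x : ℤ} (hx : x ≠ 0) :
    p * hv s (x + 1) + q * hv s (x - 1) = hv s x := by
  rcases lt_or_gt_of_ne hx with h | h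
  · rw [hv_nonpos s (by omega), hv_nonpos s (by omega), hv_nonpos s (by omega)]; linarith
  · obtain ⟨n, rfl⟩ : ∃ n : ℕ, x = ((n + 1 : ℕ) : ℤ) := ⟨(x - 1).toNat, by omega⟩
    have e1 : ((n + 1 : ℕ) : ℤ) + 1 = ((n + 2 : ℕ) : ℤ) := by push_cast; ring
    have e2 : ((n + 1 : ℕ) : ℤ) - 1 = ((n : ℕ) : ℤ) := by push_cast; ring
    rw [e1, e2, hv_nat, hv_nat, hv_nat]
    have : (s^2)^(n+2) * p = (s^2)^(n+1) * q := by rw [hps]; ring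
    have h3 : q * (s^2)^n = p * (s^2)^(n+1) := by rw [hps]; ring
    have : p * (s ^ 2) ^ (n + 2) = q * (s^2)^(n+1) := by linarith
    rw [this, h3, ← add_mul]
    rw [add_comm q p, hpq, one_mul]

lemma hv_zero {s p q : ℝ} (hps : q = p * s ^ 2) :
    p * hv s (0 + 1) + q * hv s (0 - 1) = 2 * q := by
  have := hv_nat s 1
  rw [hv_nonpos s (by norm_num : (0:ℤ) - 1 ≤ 0)]
  norm_num at this ⊢
  rw [this, hps]; ring

lemma hv_super {s p q : ℝ} (hps : q = p * s ^ 2) (hpq : p + q = 1) (hq : q < 1/2) (x : ℤ) :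
    p * hv s (x + 1) + q * hv s (x - 1) ≤ hv s x := by
  by_cases hx : x = 0
  · subst hx; rw [hv_zero hps, hv_nonpos s le_rfl]; linarith
  · exact (hv_harm hps hpq hx).le

lemma hv_le_zpow {s : ℝ} (hs : 0 < s) (hs1 : s < 1) (x : ℤ) : hv s x ≤ s ^ x := by
  rcases le_or_gt x 0 with h | h
  · rw [hv_nonpos s h]
    exact one_le_zpow_of_nonpos₀ hs hs1.le h
  · obtain ⟨n, rfl⟩ : ∃ n : ℕ, x = (n : ℤ) := ⟨x.toNat, by omega⟩
    rw [hv_nat, zpow_natCast, ← pow_mul]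
    exact pow_le_pow_of_le_one hs.le hs1.le (by omega)

lemma hv_le_sq {s : ℝ} (hs : 0 < s) (hs1 : s < 1) {d : ℤ} (h : 1 ≤ d) : hv s d ≤ s ^ 2 := by
  obtain ⟨n, rfl⟩ : ∃ n : ℕ, d = ((n + 1 : ℕ) : ℤ) := ⟨(d - 1).toNat, by omega⟩
  rw [hv_nat, pow_succ]
  have : (s^2)^n ≤ 1 := pow_le_one₀ (by positivity) (by nlinarith)
  nlinarith [sq_nonneg s]

/-- Supersolution for one site. -/
lemma super_one {s p q : ℝ} (hs : 0 < s) (hs1 : s < 1) (hps : q = p * s ^ 2) (hpq : p + q = 1)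
    (hq : q < 1/2) {ρ : ℝ} (hρ : 2 * q < ρ) (hρ1 : ρ < 1) :
    ∃ C : ℝ, 0 < C ∧ ∃ u : ℤ → ℝ, (∀ x, 1 ≤ u x) ∧ u 0 ≤ C ∧
      (∀ x ∈ ({0} : Finset ℤ), p * u (x + 1) + q * u (x - 1) ≤ ρ * u x) ∧
      (∀ x ∉ ({0} : Finset ℤ), p * u (x + 1) + q * u (x - 1) ≤ u x) := by
  set A := (1 - ρ) / (ρ - 2 * q) with hA
  have hA0 : 0 < A := div_pos (by linarith) (by linarith)
  have hAe : A * (ρ - 2 * q) = 1 - ρ := div_mul_cancel₀ _ (by linarith)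
  refine ⟨1 + A, by linarith, fun x => 1 + A * hv s x, ?_, ?_, ?_, ?_⟩
  · intro x; have := mul_pos hA0 (hv_pos hs x); linarith
  · simp [hv_nonpos s le_rfl]
  · intro x hx
    rw [Finset.mem_singleton] at hx
    subst hx
    have := hv_zero hps
    beta_reduce
    rw [hv_nonpos s (le_refl 0)]
    have e : p * (1 + A * hv s (0 + 1)) + q * (1 + A * hv s (0 - 1)) = 1 + A * (2 * q) := by
      linear_combination A * this + hpq
    rw [e]; nlinarith
  · intro x _
    have := hv_super hps hpq hq x
    have := mul_le_mul_of_nonneg_left this hA0.le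
    nlinarith

/-- Supersolution for two sites. -/
lemma super_two {s p q : ℝ} (hs : 0 < s) (hs1 : s < 1) (hps : q = p * s ^ 2) (hpq : p + q = 1)
    (hq : q < 1/2) {ρ : ℝ} (hρ : (2 * q + s) / (1 + s) < ρ) (hρ1 : ρ < 1) :
    ∃ C : ℝ, 0 < C ∧ ∀ d : ℤ, d ≠ 0 → ∃ u : ℤ → ℝ, (∀ x, 1 ≤ u x) ∧ u 0 ≤ C ∧
      (∀ x ∈ ({0, d} : Finset ℤ), p * u (x + 1) + q * u (x - 1) ≤ ρ * u x) ∧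
      (∀ x ∉ ({0, d} : Finset ℤ), p * u (x + 1) + q * u (x - 1) ≤ u x) := by
  rw [div_lt_iff₀ (by linarith)] at hρ
  have hρq : 2 * q < ρ := by nlinarith
  set K := (1 - ρ) / (ρ - 2 * q) with hK
  have hK0 : 0 < K := div_pos (by linarith) (by linarith)
  have hKe : K * (ρ - 2 * q) = 1 - ρ := div_mul_cancel₀ _ (by linarith)
  have hKs : K * s < 1 := by
    have : (K * s) * (ρ - 2 * q) < 1 * (ρ - 2 * q) := by nlinarith
    exact lt_of_mul_lt_mul_right this (by linarith)
  have hKs0 : 0 < K * s := by positivity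
  have hKh : 0 < 1 - K ^ 2 * s ^ 2 := by nlinarith
  set B := K * (1 + K * s ^ 2) / (1 - K ^ 2 * s ^ 2) with hB
  have hB0 : 0 < B := by positivity
  have hBe : B = K * (1 + K * (1 + B) * s ^ 2) := by
    have : B * (1 - K ^ 2 * s ^ 2) = K * (1 + K * s ^ 2) := div_mul_cancel₀ _ hKh.ne'
    linarith
  set A := K * (1 + B) with hA
  have hA0 : 0 < A := by positivity
  have main : ∀ d : ℤ, 1 ≤ d → 
      (∀ x ∈ ({0, d} : Finset ℤ), p * (1 + A * hv s (x + 1) + B * hv s (x + 1 - d)) +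
        q * (1 + A * hv s (x - 1) + B * hv s (x - 1 - d)) ≤
          ρ * (1 + A * hv s x + B * hv s (x - d))) ∧
      (∀ x : ℤ, p * (1 + A * hv s (x + 1) + B * hv s (x + 1 - d)) +
        q * (1 + A * hv s (x - 1) + B * hv s (x - 1 - d)) ≤
          (1 + A * hv s x + B * hv s (x - d))) := by
    intro d hd
    constructor
    · intro x hx
      rw [Finset.mem_insert, Finset.mem_singleton] at hx
      rcases hx with rfl | rfl
      · have h0 := hv_zero hps
        rw [hv_nonpos s (le_refl 0), hv_nonpos s (show (0:ℤ) + 1 - d ≤ 0 by omega),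
          hv_nonpos s (show (0:ℤ) - 1 - d ≤ 0 by omega), hv_nonpos s (show (0:ℤ) - d ≤ 0 by omega)]
        have e : p * (1 + A * hv s (0 + 1) + B * 1) + q * (1 + A * hv s (0 - 1) + B * 1)
            = (p + q) * (1 + B) + A * (2 * q) := by
          rw [← h0]; ring
        rw [e, hpq]
        have : A * (ρ - 2 * q) = (1 - ρ) * (1 + B) := by rw [hA, ← hKe]; ring
        linarith
      · have h0 := hv_zero hps
        have h1 := hv_harm hps hpq (show x ≠ 0 by omega)
        have hsq := hv_le_sq hs hs1 hd
        rw [show x + 1 - x = 0 + 1 by ring, show x - 1 - x = 0 - 1 by ring,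
          show x - x = 0 by ring, hv_nonpos s (le_refl 0)]
        have e : p * (1 + A * hv s (x + 1) + B * hv s (0 + 1)) +
            q * (1 + A * hv s (x - 1) + B * hv s (0 - 1))
            = (p + q) + A * hv s x + B * (2 * q) := by
          rw [← h0, ← h1]; ring
        rw [e, hpq]
        have h2 : B * (ρ - 2 * q) = (1 - ρ) * (1 + A * s ^ 2) := by
          rw [← hKe]
          calc B * (ρ - 2 * q) = (K * (1 + K * (1 + B) * s ^ 2)) * (ρ - 2 * q) := by rw [← hBe]
            _ = _ := by rw [hA]; ring
        have h3 : (1 - ρ) * (1 + A * hv s x) ≤ (1 - ρ) * (1 + A * s ^ 2) := by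
          apply mul_le_mul_of_nonneg_left _ (by linarith)
          have := mul_le_mul_of_nonneg_left hsq hA0.le
          linarith
        linarith
    · intro x
      have h1 := mul_le_mul_of_nonneg_left (hv_super hps hpq hq x) hA0.le
      have h2 := mul_le_mul_of_nonneg_left (hv_super hps hpq hq (x - d)) hB0.le
      rw [show x - d + 1 = x + 1 - d by ring, show x - d - 1 = x - 1 - d by ring] at h2
      have : p * (1 + A * hv s (x + 1) + B * hv s (x + 1 - d)) +
        q * (1 + A * hv s (x - 1) + B * hv s (x - 1 - d)) = (p + q) + 
        A * (p * hv s (x + 1) + q * hv s (x - 1)) +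
        B * (p * hv s (x + 1 - d) + q * hv s (x - 1 - d)) := by ring
      rw [this, hpq]; linarith
  refine ⟨1 + A + B, by linarith, ?_⟩
  have bd : ∀ x y : ℤ, 1 ≤ 1 + A * hv s x + B * hv s y ∧
      1 + A * hv s x + B * hv s y ≤ 1 + A + B := by
    intro x y
    have := mul_pos hA0 (hv_pos hs x)
    have := mul_pos hB0 (hv_pos hs y)
    have := mul_le_mul_of_nonneg_left (hv_le_one hs hs1 x) hA0.le
    have := mul_le_mul_of_nonneg_left (hv_le_one hs hs1 y) hB0.le
    constructor <;> linarith
  intro d hd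
  rcases lt_or_gt_of_ne hd with h | h
  · obtain ⟨m1, m2⟩ := main (-d) (by omega)
    refine ⟨fun x => 1 + A * hv s (x - d) + B * hv s (x - d - (-d)), fun x => (bd _ _).1,
      (bd _ _).2, ?_, ?_⟩
    · intro x hx
      have := m1 (x - d) (by
        simp only [Finset.mem_insert, Finset.mem_singleton] at hx ⊢; omega)
      simp only
      rw [show x + 1 - d = x - d + 1 by ring, show x - 1 - d = x - d - 1 by ring]
      exact this
    · intro x hx
      have := m2 (x - d)
      simp only
      rw [show x + 1 - d = x - d + 1 by ring, show x - 1 - d = x - d - 1 by ring]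
      exact this
  · obtain ⟨m1, m2⟩ := main d (by omega)
    exact ⟨fun x => 1 + A * hv s x + B * hv s (x - d), fun x => (bd _ _).1, (bd _ _).2,
      m1, fun x _ => m2 x⟩

lemma tail_bound [MeasurableSpace Ω] {P : Measure Ω} [IsProbabilityMeasure P]
    {X : ℕ → Ω → ℤ} {p q : ℝ} (hq0 : 0 < q) (hp0 : 0 < p) (hpq : p + q = 1)
    (hX : IsAsymmetricSRW P X p q) (A : Finset ℤ) {ρ : ℝ} (hρ0 : 0 < ρ) (hρ1 : ρ < 1)
    (u : ℤ → ℝ) (hu1 : ∀ x, 1 ≤ u x)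
    (hA : ∀ x ∈ A, p * u (x + 1) + q * u (x - 1) ≤ ρ * u x)
    (hA' : ∀ x ∉ A, p * u (x + 1) + q * u (x - 1) ≤ u x) (i t : ℕ) (κ : ℝ) :
    P {ω | κ ≤ (Nv X A i t ω : ℝ)} ≤ ENNReal.ofReal (u 0 * ρ ^ κ) := by
  have h1 : ∀ t, ∫⁻ ω, ENNReal.ofReal ((ρ⁻¹) ^ (Nv X A i t ω) * u (S X (i + t) ω - S X i ω)) ∂P
      ≤ ENNReal.ofReal (u 0) := by
    intro t
    induction t with
    | zero => simp [Nv]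
    | succ t ih =>
      refine le_trans ?_ ih
      have := chain_step hq0 hp0 hpq hX A i t Set.univ MeasurableSet.univ
        (fun x c => (ρ⁻¹) ^ c * u x) (fun x c => mul_nonneg (by positivity)
          (by linarith [hu1 x]))
      simp only [Measure.restrict_univ] at this
      rw [this]
      apply lintegral_mono
      intro ω
      apply ENNReal.ofReal_le_ofReal
      set x := S X (i + t) ω - S X i ω
      set c := Nv X A i t ω
      have hc : 0 < (ρ⁻¹) ^ c := by positivity
      by_cases hx : x ∈ A
      · simp only [hx, if_true]
        have h2 := mul_le_mul_of_nonneg_left (hA x hx) (by positivity : 0 ≤ (ρ⁻¹)^(c+1))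
        have h3 : (ρ⁻¹)^(c+1) * (ρ * u x) = (ρ⁻¹)^c * u x := by
          rw [pow_succ]; field_simp
        linarith
      · simp only [hx, if_false, add_zero]
        have h2 := mul_le_mul_of_nonneg_left (hA' x hx) hc.le
        linarith
  have hsub : {ω | κ ≤ (Nv X A i t ω : ℝ)} ⊆ {ω | ENNReal.ofReal (ρ ^ (-κ)) ≤
      ENNReal.ofReal ((ρ⁻¹) ^ (Nv X A i t ω) * u (S X (i + t) ω - S X i ω))} := by
    intro ω hω
    simp only [Set.mem_ofPred_eq] at hω ⊢
    apply ENNReal.ofReal_le_ofReal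
    have e : (ρ⁻¹) ^ (Nv X A i t ω) = ρ ^ (-(Nv X A i t ω : ℝ)) := by
      rw [Real.rpow_neg hρ0.le, Real.rpow_natCast, inv_pow]
    rw [e]
    have h2 : ρ ^ (-κ) ≤ ρ ^ (-(Nv X A i t ω : ℝ)) :=
      Real.rpow_le_rpow_of_exponent_ge hρ0 hρ1.le (by linarith)
    have h3 : 0 < ρ ^ (-(Nv X A i t ω : ℝ)) := by positivity
    nlinarith [hu1 (S X (i + t) ω - S X i ω)]
  refine (measure_mono hsub).trans ?_
  have hpos : 0 < ρ ^ (-κ) := by positivity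
  have hm : Measurable (fun ω => ENNReal.ofReal
      ((ρ⁻¹) ^ (Nv X A i t ω) * u (S X (i + t) ω - S X i ω))) := by
    have hs : Measurable[pastSig X (i + t)] (fun ω => S X (i + t) ω - S X i ω) :=
      (meas_S_past X (by omega)).sub (meas_S_past X (by omega))
    have hpair := (hs.prodMk (meas_Nv X A i t)).mono (pastSig_le hX.1 _) le_rfl
    exact (measurable_of_countable (fun y : ℤ × ℕ => ENNReal.ofReal ((ρ⁻¹) ^ y.2 * u y.1))).comp
      hpair
  refine (meas_ge_le_lintegral_div hm.aemeasurable (by simp [hpos]) ENNReal.ofReal_ne_top).trans ?_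
  rw [ENNReal.ofReal_mul (by linarith [hu1 0])]
  rw [ENNReal.div_eq_inv_mul, ← ENNReal.ofReal_inv_of_pos hpos, ← Real.rpow_neg hρ0.le, neg_neg,
    mul_comm]
  gcongr
  exact h1 t

lemma lower_bound [MeasurableSpace Ω] {P : Measure Ω} [IsProbabilityMeasure P]
    {X : ℕ → Ω → ℤ} {p q s : ℝ} (hq0 : 0 < q) (hp0 : 0 < p) (hpq : p + q = 1)
    (hX : IsAsymmetricSRW P X p q) (hs : 0 < s) (hs1 : s < 1) (hps : q = p * s ^ 2)
    (hq : q < 1/2) (i k L : ℕ) (G : Set Ω) (hG : MeasurableSet[pastSig X i] G) :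
    ENNReal.ofReal ((2 * q) ^ k) * P G ≤
      P (G ∩ {ω | k + 1 ≤ Nv X {0} i L ω}) + ENNReal.ofReal ((2 * p * s) ^ L) * P G := by
  have hGm : MeasurableSet G := pastSig_le hX.1 i _ hG
  let H : ℤ → ℕ → ℝ := fun x c => if k + 1 ≤ c then 1 else hv s x * (2 * q) ^ (k - c)
  have hH : ∀ x c, 0 ≤ H x c := by
    intro x c; simp only [H]; split_ifs
    · exact zero_le_one
    · have := hv_pos hs x; positivity
  have h1 : ∀ t, ∫⁻ ω in G, ENNReal.ofReal (H (S X (i + t) ω - S X i ω) (Nv X {0} i t ω)) ∂P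
      = ENNReal.ofReal ((2 * q) ^ k) * P G := by
    intro t
    induction t with
    | zero => simp [Nv, H, hv_nonpos]
    | succ t ih =>
      rw [← ih, chain_step hq0 hp0 hpq hX {0} i t G hG H hH]
      apply lintegral_congr
      intro ω
      congr 1
      set x := S X (i + t) ω - S X i ω
      set c := Nv X {0} i t ω
      simp only [H]
      by_cases hx : x = 0
      · have hx' : x ∈ ({0} : Finset ℤ) := by simp [hx]
        rw [if_pos hx', hx]
        by_cases hc : k + 1 ≤ c
        · simp only [hc, if_true, show k + 1 ≤ c + 1 by omega]; linarith
        · rw [hv_nonpos s (le_refl 0)]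
          by_cases hc' : k = c
          · simp [hc']; linarith
          · simp only [hc, if_false, show ¬ (k + 1 ≤ c + 1) by omega]
            rw [show k - c = (k - (c + 1)) + 1 by omega, pow_succ]
            linear_combination (2 * q) ^ (k - (c + 1)) * hv_zero (s := s) hps
      · have hx' : x ∉ ({0} : Finset ℤ) := by simp [hx]
        simp only [hx', if_false, add_zero]
        split_ifs
        · linarith
        · rw [← hv_harm hps hpq hx]; ring
  have h2 : ∀ t, ∫⁻ ω in G, ENNReal.ofReal (s ^ (S X (i + t) ω - S X i ω)) ∂P
      = ENNReal.ofReal ((2 * p * s) ^ t) * P G := by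
    intro t
    induction t with
    | zero => simp
    | succ t ih =>
      rw [chain_step hq0 hp0 hpq hX {0} i t G hG (fun x _ => s ^ x) (fun x _ => by positivity)]
      rw [pow_succ', ENNReal.ofReal_mul (by positivity), mul_assoc, ← ih,
        ← lintegral_const_mul' _ _ ENNReal.ofReal_ne_top]
      apply lintegral_congr
      intro ω
      rw [← ENNReal.ofReal_mul (by positivity)]
      congr 1
      generalize S X (i + t) ω - S X i ω = x
      rw [zpow_add₀ hs.ne', zpow_sub₀ hs.ne', zpow_one, hps]
      field_simp
      ring
  rw [← h1 L, ← h2 L]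
  have hmN : Measurable (Nv X {0} i L) := (meas_Nv X {0} i L).mono (pastSig_le hX.1 _) le_rfl
  have hmE : MeasurableSet {ω | k + 1 ≤ Nv X {0} i L ω} := hmN (measurableSet_Ici (a := k + 1))
  have e : P (G ∩ {ω | k + 1 ≤ Nv X {0} i L ω}) =
      ∫⁻ ω in G, {ω | k + 1 ≤ Nv X {0} i L ω}.indicator 1 ω ∂P := by
    rw [lintegral_indicator_one hmE, Measure.restrict_apply hmE, Set.inter_comm]
  rw [e, ← lintegral_add_left (measurable_one.indicator hmE)]
  apply lintegral_mono
  intro ω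
  simp only [H, Set.indicator, Set.mem_ofPred_eq]
  split_ifs with h
  · simp
  · simp only [zero_add]
    apply ENNReal.ofReal_le_ofReal
    have h3 := hv_le_zpow hs hs1 (S X (i + L) ω - S X i ω)
    have h4 : (2 * q) ^ (k - Nv X {0} i L ω) ≤ 1 := pow_le_one₀ (by linarith) (by linarith)
    have h5 := hv_pos hs (S X (i + L) ω - S X i ω)
    nlinarith

lemma exists_start (X : ℕ → Ω → ℤ) (ω : Ω) (x y : ℤ) {n M : ℕ} (hnM : n ≤ M)
    (hpos : ∃ k ∈ Finset.Icc 1 n, S X k ω = x) :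
    ∃ i ∈ Finset.Icc 1 n, ∃ d : ℤ, (d = y - x ∨ d = x - y) ∧
      ((Finset.Icc 1 n).filter (fun k => S X k ω = x ∨ S X k ω = y)).card ≤ Nv X {0, d} i M ω := by
  classical
  set T := (Finset.Icc 1 n).filter (fun k => S X k ω = x ∨ S X k ω = y) with hT
  have hne : T.Nonempty := by
    obtain ⟨k, hk, hkx⟩ := hpos
    exact ⟨k, by rw [hT, Finset.mem_filter]; exact ⟨hk, Or.inl hkx⟩⟩
  have hi := T.min'_mem hne
  set i := T.min' hne with hidef
  rw [hT, Finset.mem_filter] at hi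
  have key : ∀ d : ℤ, (∀ k, (S X k ω = x ∨ S X k ω = y) → S X k ω - S X i ω ∈ ({0, d} : Finset ℤ)) →
      T.card ≤ Nv X {0, d} i M ω := by
    intro d hd
    unfold Nv
    apply Finset.card_le_card_of_injOn (fun k => k - i)
    · intro k hk
      have hik : i ≤ k := T.min'_le k hk
      rw [Finset.mem_coe, hT, Finset.mem_filter, Finset.mem_Icc] at hk
      rw [Finset.mem_coe, Finset.mem_filter, Finset.mem_range]
      have h1 := (Finset.mem_Icc.1 hi.1).1
      beta_reduce
      refine ⟨by omega, ?_⟩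
      rw [show i + (k - i) = k by omega]
      exact hd k hk.2
    · intro k hk l hl hkl
      have hik : i ≤ k := T.min'_le k hk
      have hil : i ≤ l := T.min'_le l hl
      simp only at hkl
      omega
  rcases hi.2 with h | h
  · refine ⟨i, hi.1, y - x, Or.inl rfl, key _ ?_⟩
    intro k hk
    rw [h, Finset.mem_insert, Finset.mem_singleton]
    omega
  · refine ⟨i, hi.1, x - y, Or.inr rfl, key _ ?_⟩
    intro k hk
    rw [h, Finset.mem_insert, Finset.mem_singleton]
    omega

lemma union_bound [MeasurableSpace Ω] {P : Measure Ω} {X : ℕ → Ω → ℤ} (M : ℕ) (Ds : Finset ℤ)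
    (κ b : ℝ)
    (h : ∀ i, ∀ d ∈ Ds, P {ω | κ ≤ (Nv X {0, d} i M ω : ℝ)} ≤ ENNReal.ofReal b) :
    P {ω | ∃ i ∈ Finset.Icc 1 M, ∃ d ∈ Ds, κ ≤ (Nv X {0, d} i M ω : ℝ)} ≤
      ENNReal.ofReal (M * Ds.card * b) := by
  have hsub : {ω | ∃ i ∈ Finset.Icc 1 M, ∃ d ∈ Ds, κ ≤ (Nv X {0, d} i M ω : ℝ)} ⊆
      ⋃ z ∈ Finset.Icc 1 M ×ˢ Ds, {ω | κ ≤ (Nv X {0, z.2} z.1 M ω : ℝ)} := by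
    rintro ω ⟨i, hi, d, hd, hκ⟩
    rw [Set.mem_iUnion₂]
    exact ⟨(i, d), Finset.mem_product.2 ⟨hi, hd⟩, hκ⟩
  refine (measure_mono hsub).trans ((measure_biUnion_finset_le _ _).trans ?_)
  refine (Finset.sum_le_sum (g := fun _ => ENNReal.ofReal b) ?_).trans ?_
  · intro z hz; exact h _ _ (Finset.mem_product.1 hz).2
  · rw [Finset.sum_const, Finset.card_product, nsmul_eq_mul, Nat.card_Icc]
    rw [ENNReal.ofReal_mul (by positivity), ← Nat.cast_mul, ENNReal.ofReal_natCast]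
    simp

lemma S_diff_le {X : ℕ → Ω → ℤ} {ω : Ω} (h : ∀ n, X n ω = 1 ∨ X n ω = -1) (i t : ℕ) :
    |S X (i + t) ω - S X i ω| ≤ t := by
  induction t with
  | zero => simp
  | succ t ih =>
    rw [← add_assoc, S_succ]
    rw [abs_le] at ih ⊢
    push_cast
    rcases h (i + t) with h | h <;> rw [h] <;> omega

lemma exists_max (X : ℕ → Ω → ℤ) (n : ℕ) (ω : Ω) :
    ∃ z, localTime X z n ω = maxLocalTime X n ω := by
  have : maxLocalTime X n ω ∈ Set.range fun z : ℤ => localTime X z n ω := by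
    apply Nat.sSup_mem (Set.range_nonempty _)
    refine ⟨n, ?_⟩
    rintro _ ⟨z, rfl⟩
    have := Finset.card_filter_le (Finset.Icc 1 n) (fun k => S X k ω = z)
    simpa [localTime] using this
  exact this

/-- Deterministic upper estimate. -/
lemma max_upper (X : ℕ → Ω → ℤ) (n : ℕ) (ω : Ω) (τ : ℝ) (hτ : 0 ≤ τ)
    (h : τ < maxLocalTime X n ω) :
    ∃ i ∈ Finset.Icc 1 n, ∃ d ∈ ({0} : Finset ℤ), τ ≤ (Nv X {0, d} i n ω : ℝ) := by
  obtain ⟨z, hz⟩ := exists_max X n ω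
  have hpos : ∃ k ∈ Finset.Icc 1 n, S X k ω = z := by
    have : 0 < localTime X z n ω := by
      rw [hz]; exact_mod_cast lt_of_le_of_lt hτ h
    obtain ⟨k, hk⟩ := Finset.card_pos.1 this
    rw [Finset.mem_filter] at hk
    exact ⟨k, hk⟩
  obtain ⟨i, hi, d, hd, hc⟩ := exists_start X ω z z le_rfl hpos
  refine ⟨i, hi, d, by simpa using hd, ?_⟩
  have : localTime X z n ω ≤ Nv X {0, d} i n ω := by
    simpa [localTime] using hc
  rw [← hz] at h
  exact h.le.trans (by exact_mod_cast this)

lemma max_lower (X : ℕ → Ω → ℤ) (n i L : ℕ) (ω : Ω) (hi : 1 ≤ i) (hL : i + L ≤ n + 1) :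
    Nv X {0} i L ω ≤ maxLocalTime X n ω := by
  refine le_trans ?_ (localTime_le_max X (S X i ω) n ω)
  unfold Nv localTime
  apply Finset.card_le_card_of_injOn (fun l => i + l)
  · intro l hl
    simp only [Finset.coe_filter, Finset.mem_range, Finset.mem_singleton, Set.mem_ofPred_eq,
      Finset.mem_Icc] at hl ⊢
    refine ⟨by omega, by omega⟩
  · intro a _ b _ hab
    simp only at hab
    omega

/-- Deterministic estimate for the pair count. -/
lemma F_pos {X : ℕ → Ω → ℤ} {ω : Ω} (hω : ∀ n, X n ω = 1 ∨ X n ω = -1) {q ε : ℝ} {n M : ℕ}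
    (hnM : n ≤ M) (hF : Fcount q X ε (n : ℝ) (n : ℝ) ω ≠ 0) :
    ∃ i ∈ Finset.Icc 1 M, ∃ d : ℤ, d ≠ 0 ∧
      (d.natAbs : ℝ) ≤ 2 * (-1 / Real.log (2*q)) * Real.log n ∧
      2 * ((1 - ε) * (-1 / Real.log (2*q)) * Real.log n) ≤ (Nv X {0, d} i M ω : ℝ) := by
  unfold Fcount at hF
  obtain ⟨i, hi, hF⟩ := Finset.exists_ne_zero_of_sum_ne_zero hF
  obtain ⟨j, hj, hF⟩ := Finset.exists_ne_zero_of_sum_ne_zero hF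
  rw [Nat.floor_natCast] at hi hj hF
  split_ifs at hF with hc
  · obtain ⟨h1, -, hne⟩ := hc
    rw [Finset.mem_Icc] at hj
    obtain ⟨hij, hj⟩ := hj
    obtain ⟨hj1, hj2⟩ := le_min_iff.1 hj
    obtain ⟨i0, hi0, d, hd, hcard⟩ := exists_start X ω (S X i ω) (S X j ω) hnM ⟨i, hi, rfl⟩
    rw [Finset.mem_Icc] at hi0
    refine ⟨i0, Finset.mem_Icc.2 ⟨hi0.1, hi0.2.trans hnM⟩, d, by omega, ?_, ?_⟩
    · have h2 := S_diff_le hω i (j - i)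
      rw [show i + (j - i) = j by omega] at h2
      have h3 : d.natAbs ≤ j - i := by
        rw [abs_le] at h2
        omega
      have h4 : (j : ℝ) ≤ (i : ℝ) + 2 * (-1 / Real.log (2*q)) * Real.log n := by
        exact (Nat.le_floor_iff' (by omega)).1 hj1
      have h5 : (d.natAbs : ℝ) + i ≤ j := by
        have : d.natAbs + i ≤ j := by omega
        exact_mod_cast this
      linarith
    · obtain ⟨ha, hb⟩ := le_min_iff.1 h1
      have h6 : localTime X (S X i ω) n ω + localTime X (S X j ω) n ω ≤ Nv X {0, d} i0 M ω := by
        refine le_trans (le_of_eq ?_) hcard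
        rw [Finset.filter_or, Finset.card_union_of_disjoint]
        · rfl
        · rw [Finset.disjoint_left]
          intro k hk hk'
          rw [Finset.mem_filter] at hk hk'
          exact hne (hk.2.symm.trans hk'.2)
      have h7 : (localTime X (S X i ω) n ω : ℝ) + localTime X (S X j ω) n ω ≤
        Nv X {0, d} i0 M ω := by exact_mod_cast h6
      linarith
  · exact absurd rfl hF

lemma block_fail [MeasurableSpace Ω] {P : Measure Ω} [IsProbabilityMeasure P]
    {X : ℕ → Ω → ℤ} {p q s : ℝ} (hq0 : 0 < q) (hp0 : 0 < p) (hpq : p + q = 1)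
    (hX : IsAsymmetricSRW P X p q) (hs : 0 < s) (hs1 : s < 1) (hps : q = p * s ^ 2)
    (hq : q < 1/2) (k L : ℕ) (r : ℝ) (hr : r ≤ (2 * q) ^ k - (2 * p * s) ^ L) (b : ℕ) :
    P.real {ω | ∀ a < b, Nv X {0} (1 + a * L) L ω < k + 1} ≤ (1 - r) ^ b := by
  have hr1 : r ≤ 1 := by
    have h1 : (2 * q) ^ k ≤ 1 := pow_le_one₀ (by linarith) (by linarith)
    have h2 : 0 ≤ (2 * p * s) ^ L := by positivity
    linarith
  induction b with
  | zero => simp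
  | succ b ih =>
    set G := {ω | ∀ a < b, Nv X {0} (1 + a * L) L ω < k + 1} with hGdef
    set E := {ω | k + 1 ≤ Nv X {0} (1 + b * L) L ω} with hE
    have hG : MeasurableSet[pastSig X (1 + b * L)] G := by
      have : G = ⋂ a, ⋂ (_ : a < b), {ω | Nv X {0} (1 + a * L) L ω < k + 1} := by
        ext ω; simp [hGdef]
      rw [this]
      refine MeasurableSet.iInter fun a => MeasurableSet.iInter fun ha => ?_
      have hle : 1 + a * L + L ≤ 1 + b * L := by nlinarith
      exact ((meas_Nv X {0} (1 + a * L) L).mono (pastSig_mono X hle) le_rfl)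
        (measurableSet_Iio (a := k + 1))
    have hEm : MeasurableSet E :=
      ((meas_Nv X {0} (1 + b * L) L).mono (pastSig_le hX.1 _) le_rfl)
        (measurableSet_Ici (a := k + 1))
    have hlow := lower_bound hq0 hp0 hpq hX hs hs1 hps hq (1 + b * L) k L G hG
    have hlow' : (2 * q) ^ k * P.real G ≤ P.real (G ∩ E) + (2 * p * s) ^ L * P.real G := by
      have := ENNReal.toReal_mono (by finiteness) hlow
      rw [ENNReal.toReal_add (by finiteness) (by finiteness), ENNReal.toReal_mul,
        ENNReal.toReal_mul, ENNReal.toReal_ofReal (by positivity),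
        ENNReal.toReal_ofReal (by positivity)] at this
      exact this
    have hsplit : P.real (G ∩ E) + P.real (G \ E) = P.real G :=
      measureReal_inter_add_sdiff hEm
    have heq : {ω | ∀ a < b + 1, Nv X {0} (1 + a * L) L ω < k + 1} = G \ E := by
      ext ω
      simp only [hGdef, hE, Set.mem_ofPred_eq, Set.mem_sdiff, not_le]
      constructor
      · intro h; exact ⟨fun a ha => h a (by omega), h b (by omega)⟩
      · rintro ⟨h1, h2⟩ a ha
        rcases Nat.lt_succ_iff_lt_or_eq.1 ha with h | rfl
        · exact h1 a h
        · exact h2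
    rw [heq, pow_succ]
    have h0 : 0 ≤ P.real G := measureReal_nonneg
    have h5 := mul_le_mul_of_nonneg_right hr h0
    have h6 := mul_le_mul_of_nonneg_right ih (by linarith : 0 ≤ 1 - r)
    nlinarith

lemma rpow_lam {y : ℝ} (hy0 : 0 < y) (b c x t : ℝ) (hx : 0 < x)
    (h : b * Real.log y = -t) : y ^ (c * (b * Real.log x)) = x ^ (-(c * t)) := by
  rw [Real.rpow_def_of_pos hy0, Real.rpow_def_of_pos hx]
  congr 1
  linear_combination c * Real.log x * h

lemma D_upper [MeasurableSpace Ω] {P : Measure Ω} [IsProbabilityMeasure P]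
    {X : ℕ → Ω → ℤ} {p q s : ℝ} (hq0 : 0 < q) (hp0 : 0 < p) (hpq : p + q = 1)
    (hX : IsAsymmetricSRW P X p q) (hs : 0 < s) (hs1 : s < 1) (hps : q = p * s ^ 2)
    (hq : q < 1/2) {ε : ℝ} (hε0 : 0 < ε) :
    ∀ᵐ ω ∂P, ∀ᶠ n : ℕ in atTop,
      (maxLocalTime X n ω : ℝ) ≤ 2 * (1 + ε/2) * (-1 / Real.log (2*q)) * Real.log n := by
  have hlog : Real.log (2 * q) < 0 := Real.log_neg (by linarith) (by linarith)
  have hlam : 0 < -1 / Real.log (2*q) := div_pos_of_neg_of_neg (by norm_num) hlog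
  set lam := -1 / Real.log (2*q) with hlamdef
  set η := (2 + ε / 2) / (2 + ε) with hη
  have hη0 : 0 < η := by positivity
  have hη1 : η < 1 := by rw [hη, div_lt_one (by linarith)]; linarith
  set ρ := (2 * q) ^ η with hρ
  have hρ0 : 0 < ρ := by positivity
  have hρ1 : ρ < 1 := Real.rpow_lt_one (by linarith) (by linarith) hη0
  have hρq : 2 * q < ρ := by
    have := Real.rpow_lt_rpow_of_exponent_gt (by linarith : 0 < 2 * q) (by linarith) hη1
    simpa using this
  obtain ⟨C, hC, u, hu1, hu0, hA, hA'⟩ := super_one hs hs1 hps hpq hq hρq hρ1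
  have hbound : ∀ n : ℕ, 1 ≤ n → P {ω | ∃ i ∈ Finset.Icc 1 n, ∃ d ∈ ({0} : Finset ℤ),
      2 * (1 + ε/2) * lam * Real.log n ≤ (Nv X {0, d} i n ω : ℝ)} ≤
      ENNReal.ofReal (C * (1 / (n : ℝ) ^ (1 + ε / 2))) := by
    intro n hn
    have hn0 : (0 : ℝ) < n := by exact_mod_cast hn
    refine (union_bound n {0} _ (C * ρ ^ (2 * (1 + ε/2) * lam * Real.log n)) ?_).trans ?_
    · intro i d hd
      rw [Finset.mem_singleton] at hd
      subst hd
      rw [Finset.pair_eq_singleton]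
      refine (tail_bound hq0 hp0 hpq hX {0} hρ0 hρ1 u hu1 hA hA' i n _).trans ?_
      apply ENNReal.ofReal_le_ofReal
      gcongr
    · apply ENNReal.ofReal_le_ofReal
      apply le_of_eq
      have e : ρ ^ (2 * (1 + ε/2) * lam * Real.log n) = (n : ℝ) ^ (-(2 * (1 + ε / 2) * η)) := by
        rw [show 2 * (1 + ε/2) * lam * Real.log n = (2 * (1 + ε/2)) * (lam * Real.log n) by ring]
        apply rpow_lam hρ0 _ _ _ _ hn0
        rw [hρ, Real.log_rpow (by linarith), hlamdef]
        have := hlog.ne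
        field_simp
      have e2 : 2 * (1 + ε / 2) * η = 1 + (1 + ε / 2) := by
        rw [hη]; field_simp; ring
      rw [e, e2, Real.rpow_neg hn0.le, Real.rpow_add hn0, Real.rpow_one]
      have : (n : ℝ) ^ (1 + ε/2) ≠ 0 := by positivity
      simp
      field_simp
  have hsum : ∑' n : ℕ, P {ω | 1 ≤ n ∧ ∃ i ∈ Finset.Icc 1 n, ∃ d ∈ ({0} : Finset ℤ),
      2 * (1 + ε/2) * lam * Real.log n ≤ (Nv X {0, d} i n ω : ℝ)} ≠ ∞ := by
    have hS : Summable (fun n : ℕ => C * (1 / (n : ℝ) ^ (1 + ε / 2))) :=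
      (Real.summable_one_div_nat_rpow.2 (by linarith)).mul_left C
    refine ne_top_of_le_ne_top hS.tsum_ofReal_ne_top (ENNReal.tsum_le_tsum fun n => ?_)
    by_cases hn : 1 ≤ n
    · simpa [hn] using hbound n hn
    · simp [hn]
  filter_upwards [ae_eventually_notMem hsum] with ω hω
  filter_upwards [hω, eventually_ge_atTop 1] with n hn hn1
  by_contra hcon
  push Not at hcon
  apply hn
  refine ⟨hn1, max_upper X n ω _ ?_ hcon⟩
  have : 0 ≤ Real.log n := Real.log_natCast_nonneg n
  positivity

lemma E_event [MeasurableSpace Ω] {P : Measure Ω} [IsProbabilityMeasure P]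
    {X : ℕ → Ω → ℤ} {p q s : ℝ} (hq0 : 0 < q) (hp0 : 0 < p) (hpq : p + q = 1)
    (hX : IsAsymmetricSRW P X p q) (hs : 0 < s) (hs1 : s < 1) (hps : q = p * s ^ 2)
    (hq : q < 1/2) {δ ε : ℝ} (hε : ε ∈ Set.Ioo (0:ℝ) 1)
    (hδ : δ = 2 * Real.log ((2*q + s) / (1 + s)) / Real.log (2*q) - 1)
    (hε2 : (1 + δ) * (1 - ε)^2 > 1 + δ/2) :
    ∀ᵐ ω ∂P, ∀ᶠ n : ℕ in atTop, Fcount q X ε (n : ℝ) (n : ℝ) ω = 0 := by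
  obtain ⟨hε0, hε1⟩ := hε
  have hlog : Real.log (2 * q) < 0 := Real.log_neg (by linarith) (by linarith)
  have hlam : 0 < -1 / Real.log (2*q) := div_pos_of_neg_of_neg (by norm_num) hlog
  set lam := -1 / Real.log (2*q) with hlamdef
  set r := (2*q + s) / (1 + s) with hr
  have hr0 : 0 < r := by positivity
  have hr1 : r < 1 := by rw [hr, div_lt_one (by linarith)]; linarith
  have hδ0 : 0 < δ := by
    have h1 : r ^ 2 < 2 * q := by
      rw [hr, div_pow, div_lt_iff₀ (by positivity)]
      have h2 : 0 < 2 * q - s ^ 2 := by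
        have : s ^ 2 * p = q := by linarith
        nlinarith
      nlinarith
    have h2 := Real.log_lt_log (by positivity) h1
    rw [Real.log_pow] at h2
    push_cast at h2
    have : 1 < 2 * Real.log r / Real.log (2 * q) := (one_lt_div_of_neg hlog).2 h2
    linarith
  set ρ := r ^ (1 - ε) with hρ
  have hρ0 : 0 < ρ := by positivity
  have hρ1 : ρ < 1 := Real.rpow_lt_one hr0.le hr1 (by linarith)
  have hρr : r < ρ := by
    have := Real.rpow_lt_rpow_of_exponent_gt hr0 hr1 (by linarith : 1 - ε < 1)
    simpa using this
  obtain ⟨C, hC, hsup⟩ := super_two hs hs1 hps hpq hq hρr hρ1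
  let κ : ℕ → ℝ := fun m => 2 * ((1 - ε) * lam * Real.log ((2 ^ m : ℕ) : ℝ))
  let Dm : ℕ → ℕ := fun m => ⌊2 * lam * Real.log ((2 ^ (m + 1) : ℕ) : ℝ)⌋₊
  let Ds : ℕ → Finset ℤ := fun m => (Finset.Icc (-(Dm m : ℤ)) (Dm m)).erase 0
  have hcard : ∀ m, ((Ds m).card : ℝ) ≤ 4 * lam * Real.log 2 * (m + 1) := by
    intro m
    have h0 : (0 : ℤ) ∈ Finset.Icc (-(Dm m : ℤ)) (Dm m) := by
      rw [Finset.mem_Icc]; omega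
    have h1 : (Ds m).card = 2 * Dm m := by
      simp only [Ds]
      rw [Finset.card_erase_of_mem h0, Int.card_Icc]; omega
    have h2 : (Dm m : ℝ) ≤ 2 * lam * Real.log ((2 ^ (m + 1) : ℕ) : ℝ) :=
      Nat.floor_le (mul_nonneg (by linarith) (Real.log_natCast_nonneg _))
    rw [h1]
    push_cast at h2 ⊢
    rw [Real.log_pow] at h2
    push_cast at h2
    linarith
  have hbound : ∀ m : ℕ, P {ω | ∃ i ∈ Finset.Icc 1 (2 ^ (m + 1)), ∃ d ∈ Ds m,
      κ m ≤ (Nv X {0, d} i (2 ^ (m + 1)) ω : ℝ)} ≤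
      ENNReal.ofReal ((8 * lam * Real.log 2 * C) * (((m : ℝ) + 1) * ((2 : ℝ) ^ (-(δ / 2))) ^ m)) := by
    intro m
    refine (union_bound (2 ^ (m + 1)) (Ds m) _ (C * ρ ^ (κ m)) ?_).trans ?_
    · intro i d hd
      obtain ⟨u, hu1, hu0, hA, hA'⟩ := hsup d (Finset.ne_of_mem_erase hd)
      refine (tail_bound hq0 hp0 hpq hX {0, d} hρ0 hρ1 u hu1 hA hA' i _ _).trans ?_
      apply ENNReal.ofReal_le_ofReal
      gcongr
    · apply ENNReal.ofReal_le_ofReal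
      have hx0 : (0 : ℝ) < ((2 ^ m : ℕ) : ℝ) := by positivity
      have hx1 : (1 : ℝ) ≤ ((2 ^ m : ℕ) : ℝ) := by exact_mod_cast Nat.one_le_two_pow
      have e : ρ ^ (κ m) = ((2 ^ m : ℕ) : ℝ) ^ (-(1 * ((1 + δ) * (1 - ε) ^ 2))) := by
        have : κ m = 1 * ((2 * (1 - ε) * lam) * Real.log ((2 ^ m : ℕ) : ℝ)) := by
          simp only [κ]; ring
        rw [this]
        apply rpow_lam hρ0 _ _ _ _ hx0
        rw [hρ, Real.log_rpow hr0, hlamdef, hδ]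
        field_simp
        ring
      have e2 : ρ ^ (κ m) ≤ ((2 ^ m : ℕ) : ℝ) ^ (-(1 + δ / 2)) := by
        rw [e]
        exact Real.rpow_le_rpow_of_exponent_le hx1 (by linarith)
      have e3 : ((2 ^ m : ℕ) : ℝ) ^ (-(1 + δ / 2)) * 2 ^ m = ((2 : ℝ) ^ (-(δ / 2))) ^ m := by
        rw [← Real.rpow_natCast (2 ^ (-(δ/2))), ← Real.rpow_mul (by norm_num)]
        push_cast
        rw [← Real.rpow_natCast, ← Real.rpow_mul (by norm_num), ← Real.rpow_add (by norm_num)]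
        congr 1; ring
      have hL2 : 0 < Real.log 2 := Real.log_pos (by norm_num)
      calc ((2 ^ (m + 1) : ℕ) : ℝ) * ((Ds m).card : ℝ) * (C * ρ ^ (κ m))
          ≤ ((2 ^ (m + 1) : ℕ) : ℝ) * (4 * lam * Real.log 2 * (m + 1)) *
            (C * ((2 ^ m : ℕ) : ℝ) ^ (-(1 + δ / 2))) := by
            gcongr
            exact hcard m
        _ = (8 * lam * Real.log 2 * C) * (((m : ℝ) + 1) *
            (((2 ^ m : ℕ) : ℝ) ^ (-(1 + δ / 2)) * 2 ^ m)) := by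
            rw [show ((2 ^ (m + 1) : ℕ) : ℝ) = 2 * 2 ^ m by push_cast; ring]; ring
        _ = _ := by rw [e3]
  have hsum : ∑' m : ℕ, P {ω | ∃ i ∈ Finset.Icc 1 (2 ^ (m + 1)), ∃ d ∈ Ds m,
      κ m ≤ (Nv X {0, d} i (2 ^ (m + 1)) ω : ℝ)} ≠ ∞ := by
    have hz : ‖(2 : ℝ) ^ (-(δ / 2))‖ < 1 := by
      rw [Real.norm_of_nonneg (by positivity)]
      exact Real.rpow_lt_one_of_one_lt_of_neg (by norm_num) (by linarith)
    have hS : Summable (fun m : ℕ => (8 * lam * Real.log 2 * C) *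
        (((m : ℝ) + 1) * ((2 : ℝ) ^ (-(δ / 2))) ^ m)) := by
      apply Summable.mul_left
      have h1 := summable_pow_mul_geometric_of_norm_lt_one 1 hz
      have h2 := summable_geometric_of_norm_lt_one hz
      refine (h1.add h2).congr fun m => ?_
      ring
    exact ne_top_of_le_ne_top hS.tsum_ofReal_ne_top (ENNReal.tsum_le_tsum hbound)
  filter_upwards [ae_eventually_notMem hsum, one_step hq0 hp0 hpq hX] with ω hω hX1
  obtain ⟨m0, hm0⟩ := eventually_atTop.1 hω
  filter_upwards [eventually_ge_atTop (2 ^ m0)] with n hn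
  by_contra hF
  have hnpos : n ≠ 0 := by
    have := Nat.one_le_two_pow (n := m0)
    omega
  set m := Nat.log 2 n with hm
  have hmm : m0 ≤ m := Nat.le_log_of_pow_le (by norm_num) hn
  have h1 : 2 ^ m ≤ n := Nat.pow_log_le_self 2 hnpos
  have h2 : n ≤ 2 ^ (m + 1) := (Nat.lt_pow_succ_log_self (by norm_num) n).le
  obtain ⟨i, hi, d, hd0, hd, hN⟩ := F_pos hX1 h2 hF
  apply hm0 m hmm
  have hpos : (0 : ℝ) < ((2 ^ m : ℕ) : ℝ) := by positivity
  have hn0 : (0 : ℝ) < n := by positivity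
  have l1 : Real.log ((2 ^ m : ℕ) : ℝ) ≤ Real.log n :=
    Real.log_le_log hpos (by exact_mod_cast h1)
  have l2 : Real.log n ≤ Real.log ((2 ^ (m + 1) : ℕ) : ℝ) :=
    Real.log_le_log hn0 (by exact_mod_cast h2)
  refine ⟨i, hi, d, ?_, ?_⟩
  · have h3 : d.natAbs ≤ Dm m := by
      apply Nat.le_floor
      refine hd.trans ?_
      gcongr
    simp only [Ds]
    rw [Finset.mem_erase, Finset.mem_Icc]
    refine ⟨hd0, by omega⟩
  · refine le_trans ?_ hN
    simp only [κ]
    have : 0 ≤ 1 - ε := by linarith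
    gcongr

lemma D_lower [MeasurableSpace Ω] {P : Measure Ω} [IsProbabilityMeasure P]
    {X : ℕ → Ω → ℤ} {p q s : ℝ} (hq0 : 0 < q) (hp0 : 0 < p) (hpq : p + q = 1)
    (hX : IsAsymmetricSRW P X p q) (hs : 0 < s) (hs1 : s < 1) (hps : q = p * s ^ 2)
    (hq : q < 1/2) {ε : ℝ} (hε0 : 0 < ε) (hε1 : ε < 1) :
    ∀ᵐ ω ∂P, ∀ᶠ n : ℕ in atTop,
      (1 - ε/2) * (-1 / Real.log (2*q)) * Real.log n ≤ (maxLocalTime X n ω : ℝ) := by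
  have hlog : Real.log (2 * q) < 0 := Real.log_neg (by linarith) (by linarith)
  have hlam : 0 < -1 / Real.log (2*q) := div_pos_of_neg_of_neg (by norm_num) hlog
  set lam := -1 / Real.log (2*q) with hlamdef
  set a := ε / 2 with ha
  have ha0 : 0 < a := by linarith
  have hσ0 : 0 < 2 * p * s := by positivity
  have hσ1 : 2 * p * s < 1 := by
    have : 0 < p * (1 - s) ^ 2 := by
      have : 0 < 1 - s := by linarith
      positivity
    nlinarith
  have hlσ : Real.log (2 * p * s) < 0 := Real.log_neg hσ0 hσ1
  set c := -1 / Real.log (2 * p * s) with hc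
  have hc0 : 0 < c := div_pos_of_neg_of_neg (by norm_num) hlσ
  let κ : ℕ → ℝ := fun n => (1 - a) * lam * Real.log n
  let k : ℕ → ℕ := fun n => ⌊κ n⌋₊
  let L : ℕ → ℕ := fun n => ⌊c * Real.log n⌋₊ + 1
  let Bad : ℕ → Set Ω := fun n =>
    {ω | ∀ b < n / L n, Nv X {0} (1 + b * L n) (L n) ω < k n + 1}
  have htend : Tendsto (fun n : ℕ => Real.log (n : ℝ)) atTop atTop :=
    Real.tendsto_log_atTop.comp tendsto_natCast_atTop_atTop
  have hbound : ∀ᶠ n : ℕ in atTop, P (Bad n) ≤ ENNReal.ofReal (1 / (n : ℝ) ^ (2 : ℝ)) := by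
    filter_upwards [htend.eventually_ge_atTop 1,
      htend.eventually_ge_atTop (6 * (9 + 4 * c) / a ^ 3), eventually_ge_atTop 1] with n h1 h2 hn1
    have hn0 : (0 : ℝ) < n := by exact_mod_cast hn1
    set ℓ := Real.log (n : ℝ) with hℓ
    have hna : 1 + 4 * ℓ * (c * ℓ + 1) ≤ (n : ℝ) ^ a := by
      have h3 : (a * ℓ) ^ 3 / (Nat.factorial 3 : ℕ) ≤ Real.exp (a * ℓ) :=
        Real.pow_div_factorial_le_exp _ (by positivity) 3
      rw [Real.rpow_def_of_pos hn0, ← hℓ, mul_comm ℓ a]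
      refine le_trans ?_ h3
      rw [div_le_iff₀ (by positivity)] at h2
      have h4 : 6 * (9 + 4 * c) * ℓ ^ 2 ≤ (a * ℓ) ^ 3 := by
        calc 6 * (9 + 4 * c) * ℓ ^ 2 ≤ (ℓ * a ^ 3) * ℓ ^ 2 := by gcongr
          _ = _ := by ring
      have h5 : (Nat.factorial 3 : ℕ) = 6 := rfl
      rw [h5]
      push_cast
      rw [le_div_iff₀ (by norm_num)]
      nlinarith
    have hLpos : (0 : ℝ) < L n := by simp only [L]; push_cast; positivity
    have hLle : (L n : ℝ) ≤ c * ℓ + 1 := by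
      simp only [L]; push_cast
      have := Nat.floor_le (show 0 ≤ c * ℓ by positivity)
      linarith
    have hLge : c * ℓ ≤ L n := by
      simp only [L]; push_cast
      exact (Nat.lt_floor_add_one _).le
    have hnn : (n : ℝ) ^ a ≤ n := by
      have := Real.rpow_le_rpow_of_exponent_le (by exact_mod_cast hn1 : (1:ℝ) ≤ n)
        (by linarith : a ≤ 1)
      simpa using this
    have h2L : 2 * (L n : ℝ) ≤ n := by nlinarith [mul_pos hc0 (by linarith : 0 < ℓ)]
    set r := ((n : ℝ) ^ a - 1) / n with hr
    have hκ0 : 0 ≤ κ n := by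
      simp only [κ]
      have : 0 ≤ 1 - a := by linarith
      have : 0 ≤ Real.log (n : ℝ) := by linarith
      positivity
    have hrle : r ≤ (2 * q) ^ (k n) - (2 * p * s) ^ (L n) := by
      have e1 : (n : ℝ) ^ a / n ≤ (2 * q) ^ (k n) := by
        have e2 : (2 * q) ^ (κ n) = (n : ℝ) ^ (-((1 - a) * 1)) := by
          rw [show κ n = (1 - a) * (lam * Real.log n) by simp only [κ]; ring]
          apply rpow_lam (by linarith) _ _ _ _ hn0
          rw [hlamdef]; field_simp; rw [div_self hlog.ne]
        have e3 : (2 * q) ^ (κ n) ≤ (2 * q) ^ (k n) := by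
          rw [← Real.rpow_natCast]
          exact Real.rpow_le_rpow_of_exponent_ge (by linarith) (by linarith) (Nat.floor_le hκ0)
        refine le_trans (le_of_eq ?_) e3
        rw [e2, show -((1 - a) * 1) = a - 1 by ring, Real.rpow_sub hn0, Real.rpow_one]
      have e4 : (2 * p * s) ^ (L n) ≤ 1 / n := by
        have e5 : (2 * p * s) ^ (1 * (c * Real.log n)) = (n : ℝ) ^ (-(1 * 1 : ℝ)) := by
          apply rpow_lam hσ0 _ _ _ _ hn0
          rw [hc]; field_simp; rw [div_self hlσ.ne]
        rw [mul_one, Real.rpow_neg hn0.le, Real.rpow_one, one_mul] at e5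
        rw [one_div, ← e5, ← Real.rpow_natCast]
        exact Real.rpow_le_rpow_of_exponent_ge hσ0 hσ1.le hLge
      rw [hr, sub_div]
      linarith
    have hb := block_fail (P := P) hq0 hp0 hpq hX hs hs1 hps hq (k n) (L n) r hrle (n / L n)
    have hBlow : (n : ℝ) / (2 * L n) ≤ ((n / L n : ℕ) : ℝ) := by
      have h6 : n < (n / L n + 1) * L n := by
        have := Nat.lt_div_mul_add (a := n) (b := L n) (by simp [L])
        linarith [this]
      have h7 : (n : ℝ) < (((n / L n : ℕ) : ℝ) + 1) * L n := by exact_mod_cast h6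
      rw [div_le_iff₀ (by positivity)]
      nlinarith
    have hr0 : 0 ≤ r := by
      apply div_nonneg _ hn0.le
      have : 0 ≤ 4 * ℓ * (c * ℓ + 1) := by positivity
      linarith
    have hr1 : r ≤ 1 := by
      rw [hr, div_le_one hn0]; linarith
    have hrB : 2 * ℓ ≤ r * ((n / L n : ℕ) : ℝ) := by
      refine le_trans ?_ (mul_le_mul_of_nonneg_left hBlow hr0)
      rw [hr, div_mul_div_comm, le_div_iff₀ (by positivity)]
      have h8 : 4 * ℓ * L n ≤ (n : ℝ) ^ a - 1 := by
        have : 4 * ℓ * L n ≤ 4 * ℓ * (c * ℓ + 1) := by gcongr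
        linarith
      have := mul_le_mul_of_nonneg_right h8 hn0.le
      linarith
    have hfin : P.real (Bad n) ≤ 1 / (n : ℝ) ^ (2 : ℝ) := by
      refine hb.trans ?_
      calc (1 - r) ^ (n / L n) ≤ (Real.exp (-r)) ^ (n / L n) := by
            apply pow_le_pow_left₀ (by linarith)
            linarith [Real.add_one_le_exp (-r)]
        _ = Real.exp (-(r * ((n / L n : ℕ) : ℝ))) := by
            rw [← Real.exp_nat_mul]; congr 1; ring
        _ ≤ Real.exp (-(2 * ℓ)) := Real.exp_le_exp.2 (by linarith)
        _ = 1 / (n : ℝ) ^ (2 : ℝ) := by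
            rw [one_div, ← Real.rpow_neg hn0.le, Real.rpow_def_of_pos hn0]; congr 1; ring
    rw [← ENNReal.ofReal_toReal (measure_ne_top P (Bad n))]
    exact ENNReal.ofReal_le_ofReal hfin
  obtain ⟨n0, hn0⟩ := eventually_atTop.1 hbound
  have hsum : ∑' n : ℕ, P {ω | n0 ≤ n ∧ ω ∈ Bad n} ≠ ∞ := by
    have hS : Summable (fun n : ℕ => 1 / (n : ℝ) ^ (2 : ℝ)) :=
      Real.summable_one_div_nat_rpow.2 (by norm_num)
    refine ne_top_of_le_ne_top hS.tsum_ofReal_ne_top (ENNReal.tsum_le_tsum fun n => ?_)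
    by_cases hn : n0 ≤ n
    · refine (measure_mono ?_).trans (hn0 n hn)
      rintro ω ⟨-, h⟩; exact h
    · simp [hn]
  filter_upwards [ae_eventually_notMem hsum] with ω hω
  filter_upwards [hω, eventually_ge_atTop n0] with n hn hn1
  have hnb : ω ∉ Bad n := fun h => hn ⟨hn1, h⟩
  simp only [Bad, Set.mem_ofPred_eq] at hnb
  push Not at hnb
  obtain ⟨b, hb, hN⟩ := hnb
  have h3 : 1 + b * L n + L n ≤ n + 1 := by
    have h4 : (b + 1) * L n ≤ n :=
      le_trans (Nat.mul_le_mul_right _ hb) (Nat.div_mul_le_self n (L n))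
    linarith
  have h5 := hN.trans (max_lower X n (1 + b * L n) (L n) ω (by omega) h3)
  have h6 : ((k n : ℝ) + 1) ≤ maxLocalTime X n ω := by exact_mod_cast h5
  exact ((Nat.lt_floor_add_one (κ n)).le).trans h6

/-- For `ε ∈ (0,1)` with `(1+δ)(1-ε)² > 1+δ/2`, almost surely `D_n^ε ∩ E_n^ε`
occurs eventually. -/
theorem good_event_eventually
    [MeasurableSpace Ω] (P : Measure Ω) [IsProbabilityMeasure P]
    (X : ℕ → Ω → ℤ) (p q : ℝ) (hq0 : 0 < q) (hq : q < 1/2) (hpq : p + q = 1)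
    (hX : IsAsymmetricSRW P X p q)
    (δ : ℝ)
    (hδ : δ = 2 * Real.log ((2*q + Real.sqrt (q/p)) / (1 + Real.sqrt (q/p))) / Real.log (2*q) - 1)
    (ε : ℝ) (hε : ε ∈ Set.Ioo (0:ℝ) 1) (hε2 : (1 + δ) * (1 - ε)^2 > 1 + δ/2) :
    ∀ᵐ ω ∂P, ∃ N : ℕ, ∀ n : ℕ, N ≤ n → ω ∈ Dset q X ε n ∩ Eset q X ε n := by
  obtain ⟨hε0, hε1⟩ := hε
  have hp : 1/2 < p := by linarith
  have hp0 : 0 < p := by linarith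
  set s := Real.sqrt (q / p) with hs
  have hqp : 0 < q / p := by positivity
  have hs0 : 0 < s := Real.sqrt_pos.2 hqp
  have hs2 : s ^ 2 = q / p := Real.sq_sqrt hqp.le
  have hps : q = p * s ^ 2 := by rw [hs2]; field_simp
  have hs1 : s < 1 := by
    have : s ^ 2 < 1 := by rw [hs2, div_lt_one hp0]; linarith
    nlinarith
  filter_upwards [D_upper hq0 hp0 hpq hX hs0 hs1 hps hq hε0,
    D_lower hq0 hp0 hpq hX hs0 hs1 hps hq hε0 hε1,
    E_event hq0 hp0 hpq hX hs0 hs1 hps hq ⟨hε0, hε1⟩ hδ hε2] with ω h1 h2 h3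
  obtain ⟨N, hN⟩ := eventually_atTop.1 ((h1.and h2).and h3)
  refine ⟨N, fun n hn => ?_⟩
  obtain ⟨⟨h1, h2⟩, h3⟩ := hN n hn
  exact ⟨⟨h2, h1⟩, h3⟩
end
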